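/- arXiv:2601.16043 — 11 statements merged into one kernel-verified Lean document; each statement's English description precedes it below -/
import Mathlib

section
/- Define G : H → H by G(w) = P(T(w) − γ·g(w)). Then for all w, v ∈ H, ⟨G(w) − G(v), w − v⟩ ≤ (1/2 + η²/2 + γ²β²/2 − γα)·‖w − v‖². -/
open scoped RealInnerProductSpace

/-- The variational inequality characterising a minimiser over `K` of
`φ v + ‖w - v‖² / 2` with `φ` convex. -/
theorem ConvexOn.inner_sub_le_of_forall_add_half_norm_sq_le
    {H : Type*} [NormedAddCommGroup H] [InnerProductSpace ℝ H]
    {K : Set H} {φ : H → ℝ} (hφ : ConvexOn ℝ K φ) {w p : H} (hp : p ∈ K)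
    (hmin : ∀ v ∈ K, φ p + (1 / 2) * ‖w - p‖ ^ 2 ≤ φ v + (1 / 2) * ‖w - v‖ ^ 2)
    {v : H} (hv : v ∈ K) :
    ⟪w - p, v - p⟫ ≤ φ v - φ p := by
  have key : ∀ t : ℝ, 0 < t → t ≤ 1 →
      ⟪w - p, v - p⟫ ≤ φ v - φ p + t * (‖v - p‖ ^ 2 / 2) := by
    intro t ht ht1
    have h := hmin _ (hφ.1 hp hv (sub_nonneg.2 ht1) ht.le (sub_add_cancel 1 t))
    have hc := hφ.2 hp hv (sub_nonneg.2 ht1) ht.le (sub_add_cancel 1 t)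
    have e : w - ((1 - t) • p + t • v) = (w - p) - t • (v - p) := by module
    rw [e, norm_sub_sq_real (_ - _) (_ • _), inner_smul_right, norm_smul, mul_pow, Real.norm_eq_abs,
      sq_abs] at h
    simp only [smul_eq_mul] at hc
    refine le_of_mul_le_mul_left ?_ ht
    linarith
  have hlim : Filter.Tendsto (fun t : ℝ => φ v - φ p + t * (‖v - p‖ ^ 2 / 2))
      (nhdsWithin 0 (Set.Ioi 0)) (nhds (φ v - φ p)) := by
    have hcont : Continuous fun t : ℝ => φ v - φ p + t * (‖v - p‖ ^ 2 / 2) := by fun_prop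
    simpa using (hcont.tendsto 0).mono_left nhdsWithin_le_nhds
  refine ge_of_tendsto hlim ?_
  filter_upwards [Ioc_mem_nhdsGT (zero_lt_one' ℝ)] with t ht using key t ht.1 ht.2

/-- Minimisers over `K` of `φ v + ‖w - v‖² / 2` with `φ` convex depend on `w` nonexpansively. -/
theorem ConvexOn.norm_sub_le_of_forall_add_half_norm_sq_le
    {H : Type*} [NormedAddCommGroup H] [InnerProductSpace ℝ H]
    {K : Set H} {φ : H → ℝ} (hφ : ConvexOn ℝ K φ) {a b p q : H} (hp : p ∈ K) (hq : q ∈ K)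
    (hpmin : ∀ v ∈ K, φ p + (1 / 2) * ‖a - p‖ ^ 2 ≤ φ v + (1 / 2) * ‖a - v‖ ^ 2)
    (hqmin : ∀ v ∈ K, φ q + (1 / 2) * ‖b - q‖ ^ 2 ≤ φ v + (1 / 2) * ‖b - v‖ ^ 2) :
    ‖p - q‖ ≤ ‖a - b‖ := by
  have h₁ := hφ.inner_sub_le_of_forall_add_half_norm_sq_le hp hpmin hq
  have h₂ := hφ.inner_sub_le_of_forall_add_half_norm_sq_le hq hqmin hp
  have e : ⟪a - p, q - p⟫ + ⟪b - q, p - q⟫ = ‖p - q‖ ^ 2 - ⟪a - b, p - q⟫ := by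
    rw [← real_inner_self_eq_norm_sq, ← neg_sub p q, inner_neg_right, ← inner_neg_left,
      ← inner_add_left, ← inner_sub_left]
    congr 1
    abel
  have hcs := real_inner_le_norm (a - b) (p - q)
  by_contra! hlt
  nlinarith [norm_nonneg (a - b)]

/-- For `G w = P (T w - γ • g w)` one has
`⟪G w - G v, w - v⟫ ≤ (1/2 + η²/2 + γ²β²/2 - γα) ‖w - v‖²`. -/
theorem stmt_2
    {H : Type*} [NormedAddCommGroup H] [InnerProductSpace ℝ H] [CompleteSpace H]
    (K : Set H) (hKne : K.Nonempty) (hKcl : IsClosed K) (hKcv : Convex ℝ K)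
    (f : H → ℝ) (hfcv : ConvexOn ℝ Set.univ f) (hflsc : LowerSemicontinuous f)
    (γ : ℝ) (hγ : 0 < γ)
    (P : H → H)
    (hP : ∀ w : H, P w ∈ K ∧
      ∀ v ∈ K, γ * f (P w) + (1 / 2) * ‖w - P w‖ ^ 2 ≤ γ * f v + (1 / 2) * ‖w - v‖ ^ 2)
    (T g : H → H) (η β α : ℝ)
    (hT_lip : ∀ w v : H, ‖T w - T v‖ ≤ η * ‖w - v‖)
    (hg_lip : ∀ w v : H, ‖g w - g v‖ ≤ β * ‖w - v‖)
    (hcoupled : ∀ w v : H, ⟪T w - T v, g w - g v⟫ ≥ α * ‖w - v‖ ^ 2)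
    (G : H → H) (hG : ∀ w : H, G w = P (T w - γ • g w)) :
    ∀ w v : H, ⟪G w - G v, w - v⟫ ≤
      (1 / 2 + η ^ 2 / 2 + γ ^ 2 * β ^ 2 / 2 - γ * α) * ‖w - v‖ ^ 2 := by
  intro w v
  have hfK : ConvexOn ℝ K fun x => γ * f x :=
    (hfcv.subset (Set.subset_univ K) hKcv).smul hγ.le
  have hne : ‖G w - G v‖ ≤ ‖(T w - γ • g w) - (T v - γ • g v)‖ := by
    rw [hG, hG]
    exact hfK.norm_sub_le_of_forall_add_half_norm_sq_le (hP _).1 (hP _).1 (hP _).2 (hP _).2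
  have hne_sq := pow_le_pow_left₀ (norm_nonneg _) hne 2
  have e : (T w - γ • g w) - (T v - γ • g v) = (T w - T v) - γ • (g w - g v) := by module
  rw [e, norm_sub_sq_real (_ - _) (_ • _), inner_smul_right, norm_smul, mul_pow, Real.norm_eq_abs,
    sq_abs] at hne_sq
  have hT := pow_le_pow_left₀ (norm_nonneg _) (hT_lip w v) 2
  have hg := mul_le_mul_of_nonneg_left
    (pow_le_pow_left₀ (norm_nonneg _) (hg_lip w v) 2) (sq_nonneg γ)
  have hc := mul_le_mul_of_nonneg_left (hcoupled w v) hγ.le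
  have hyoung := real_inner_le_norm (G w - G v) (w - v)
  have hsq := two_mul_le_add_sq ‖G w - G v‖ ‖w - v‖
  linarith
end

section
/- Let w* be a solution of the GIMVIP. Then for every w ∈ H, ⟨A(w), w − w*⟩ ≥ a‖w − w*‖², where a := λ + γα − η²/2 − γ²β²/2 − 1/2. -/
open scoped RealInnerProductSpace

section

variable {H : Type*} [NormedAddCommGroup H] [InnerProductSpace ℝ H]

theorem inner_sub_le_of_isMinimizer_prox {K : Set H} (hK : Convex ℝ K) {f : H → ℝ}
    (hf : ConvexOn ℝ Set.univ f) {γ : ℝ} (hγ : 0 ≤ γ) {u p : H} (hp : p ∈ K)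
    (hmin : ∀ v ∈ K, γ * f p + (1 / 2) * ‖u - p‖ ^ 2 ≤ γ * f v + (1 / 2) * ‖u - v‖ ^ 2)
    {y : H} (hy : y ∈ K) :
    ⟪u - p, y - p⟫ ≤ γ * (f y - f p) := by
  set D := ‖y - p‖ ^ 2 with hD
  have hD0 : 0 ≤ D := sq_nonneg _
  set c := ⟪u - p, y - p⟫ - γ * (f y - f p) with hc
  have segment_bound : ∀ t : ℝ, 0 < t → t ≤ 1 → c ≤ t / 2 * D := by
    intro t ht ht1
    have hmem : (1 - t) • p + t • y ∈ K := hK hp hy (by linarith) ht.le (by ring)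
    have hfle : f ((1 - t) • p + t • y) ≤ (1 - t) * f p + t * f y :=
      hf.2 (Set.mem_univ p) (Set.mem_univ y) (by linarith) ht.le (by ring)
    have hle := hmin _ hmem
    have hnorm : ‖u - ((1 - t) • p + t • y)‖ ^ 2
        = ‖u - p‖ ^ 2 - 2 * t * ⟪u - p, y - p⟫ + t ^ 2 * D := by
      have hvec : u - ((1 - t) • p + t • y) = (u - p) - t • (y - p) := by module
      rw [hvec, norm_sub_sq_real, real_inner_smul_right, norm_smul, mul_pow, Real.norm_eq_abs,
        sq_abs]
      ring
    have hγf := mul_le_mul_of_nonneg_left hfle hγ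
    rw [hnorm] at hle
    refine le_of_mul_le_mul_left ?_ ht
    rw [hc]
    nlinarith
  by_contra! hlt
  have hcpos : 0 < c := by linarith
  have hle := segment_bound (c / (c + D)) (by positivity)
    ((div_le_one (by positivity)).2 (by linarith))
  have hfrac : c / (c + D) * D ≤ c := by
    rw [div_mul_eq_mul_div, div_le_iff₀ (by positivity)]
    nlinarith
  linarith

theorem norm_sub_le_of_variational_ineq {φ : H → ℝ} {u v p q : H}
    (hp : ⟪u - p, q - p⟫ ≤ φ q - φ p) (hq : ⟪v - q, p - q⟫ ≤ φ p - φ q) :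
    ‖p - q‖ ≤ ‖u - v‖ := by
  have hexpand : ⟪u - p, q - p⟫ + ⟪v - q, p - q⟫ = ‖p - q‖ ^ 2 - ⟪u - v, p - q⟫ := by
    rw [← real_inner_self_eq_norm_sq]
    simp only [inner_sub_left, inner_sub_right]
    ring
  have hcs := real_inner_le_norm (u - v) (p - q)
  by_contra! hlt
  nlinarith [norm_nonneg (u - v), norm_nonneg (p - q)]

end

theorem stmt_3
    {H : Type*} [NormedAddCommGroup H] [InnerProductSpace ℝ H] [CompleteSpace H]
    (K : Set H) (hKne : K.Nonempty) (hKcl : IsClosed K) (hKcv : Convex ℝ K)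
    (f : H → ℝ) (hfcv : ConvexOn ℝ Set.univ f) (hflsc : LowerSemicontinuous f)
    (γ : ℝ) (hγ : 0 < γ)
    (P : H → H)
    (hP : ∀ w : H, P w ∈ K ∧
      ∀ v ∈ K, γ * f (P w) + (1 / 2) * ‖w - P w‖ ^ 2 ≤ γ * f v + (1 / 2) * ‖w - v‖ ^ 2)
    (T g : H → H) (η lam β α : ℝ)
    (hT_lip : ∀ w v : H, ‖T w - T v‖ ≤ η * ‖w - v‖)
    (hT_mono : ∀ w v : H, ⟪T w - T v, w - v⟫ ≥ lam * ‖w - v‖ ^ 2)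
    (hg_lip : ∀ w v : H, ‖g w - g v‖ ≤ β * ‖w - v‖)
    (hcoupled : ∀ w v : H, ⟪T w - T v, g w - g v⟫ ≥ α * ‖w - v‖ ^ 2)
    (A : H → H) (hA : ∀ w : H, A w = T w - P (T w - γ • g w))
    (a : ℝ) (ha_def : a = lam + γ * α - η ^ 2 / 2 - γ ^ 2 * β ^ 2 / 2 - 1 / 2)
    
    (wstar : H)
    (hsol : T wstar ∈ K ∧ ∀ y ∈ K, ⟪g wstar, y - T wstar⟫ + f y - f (T wstar) ≥ 0) :
    ∀ w : H, ⟪A w, w - wstar⟫ ≥ a * ‖w - wstar‖ ^ 2 := by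
  intro w
  set p := P (T w - γ • g w) with hp
  have hproj : ‖p - T wstar‖ ≤ ‖(T w - γ • g w) - (T wstar - γ • g wstar)‖ := by
    refine norm_sub_le_of_variational_ineq (φ := fun x => γ * f x) ?_ ?_
    · have h := inner_sub_le_of_isMinimizer_prox hKcv hfcv hγ.le (hP (T w - γ • g w)).1
        (hP (T w - γ • g w)).2 hsol.1
      linarith
    · have h := mul_nonneg hγ.le (hsol.2 p (hP _).1)
      have hvec : T wstar - γ • g wstar - T wstar = -(γ • g wstar) := by abel
      rw [hvec, inner_neg_left, real_inner_smul_left]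
      linarith
  have hstep : ‖(T w - γ • g w) - (T wstar - γ • g wstar)‖ ^ 2
      = ‖T w - T wstar‖ ^ 2 - 2 * γ * ⟪T w - T wstar, g w - g wstar⟫
        + γ ^ 2 * ‖g w - g wstar‖ ^ 2 := by
    have hvec : (T w - γ • g w) - (T wstar - γ • g wstar)
        = (T w - T wstar) - γ • (g w - g wstar) := by module
    rw [hvec, norm_sub_sq_real, real_inner_smul_right, norm_smul, mul_pow, Real.norm_eq_abs,
      sq_abs]
    ring
  have hsplit : ⟪A w, w - wstar⟫
      = ⟪T w - T wstar, w - wstar⟫ - ⟪p - T wstar, w - wstar⟫ := by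
    rw [hA, ← inner_sub_left, sub_sub_sub_cancel_right]
  have hyoung : ⟪p - T wstar, w - wstar⟫ ≤ ‖p - T wstar‖ ^ 2 / 2 + ‖w - wstar‖ ^ 2 / 2 := by
    nlinarith [real_inner_le_norm (p - T wstar) (w - wstar),
      sq_nonneg (‖p - T wstar‖ - ‖w - wstar‖)]
  have hproj_sq := pow_le_pow_left₀ (norm_nonneg _) hproj 2
  have hT_sq := pow_le_pow_left₀ (norm_nonneg _) (hT_lip w wstar) 2
  have hg_sq := mul_le_mul_of_nonneg_left
    (pow_le_pow_left₀ (norm_nonneg _) (hg_lip w wstar) 2) (sq_nonneg γ)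
  have hcoupled_mul := mul_le_mul_of_nonneg_left (hcoupled w wstar) hγ.le
  have hmono := hT_mono w wstar
  rw [hsplit, ha_def]
  rw [hstep] at hproj_sq
  rw [mul_pow] at hT_sq hg_sq
  linarith
end

section
/- Let w* be a solution of the GIMVIP, and suppose a := λ + γα − η²/2 − γ²β²/2 − 1/2 > 0. Then for every w ∈ H, ⟨w − w*, A(w)⟩ ≥ a₁‖A(w)‖², where a₁ := a/(2η + γβ)². -/
open scoped RealInnerProductSpace

section GeneralizedProjection

variable {H : Type*} [NormedAddCommGroup H] [InnerProductSpace ℝ H]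

/-- Variational characterization of a minimizer `p` of `v ↦ γ f(v) + ‖w - v‖² / 2` over `K`. -/
theorem genProj_variational {K : Set H} (hK : Convex ℝ K) {f : H → ℝ}
    (hf : ConvexOn ℝ Set.univ f) {γ : ℝ} (hγ : 0 < γ) {w p : H} (hp : p ∈ K)
    (hmin : ∀ v ∈ K, γ * f p + (1 / 2) * ‖w - p‖ ^ 2 ≤ γ * f v + (1 / 2) * ‖w - v‖ ^ 2)
    {v : H} (hv : v ∈ K) :
    ⟪w - p, v - p⟫ ≤ γ * (f v - f p) := by
  have key : ∀ t : ℝ, 0 < t → t ≤ 1 →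
      ⟪w - p, v - p⟫ ≤ γ * (f v - f p) + t * (‖v - p‖ ^ 2 / 2) := by
    intro t ht ht1
    have hz := hmin _ (hK hp hv (sub_nonneg.2 ht1) ht.le (sub_add_cancel 1 t))
    have hfz := hf.2 (Set.mem_univ p) (Set.mem_univ v) (sub_nonneg.2 ht1) ht.le
      (sub_add_cancel 1 t)
    have hnorm : ‖w - ((1 - t) • p + t • v)‖ ^ 2 =
        ‖w - p‖ ^ 2 - 2 * (t * ⟪w - p, v - p⟫) + t ^ 2 * ‖v - p‖ ^ 2 := by
      rw [show w - ((1 - t) • p + t • v) = (w - p) - t • (v - p) by module,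
        norm_sub_sq_real, real_inner_smul_right, norm_smul, mul_pow, Real.norm_eq_abs, sq_abs]
    rw [hnorm] at hz
    have hfz' := mul_le_mul_of_nonneg_left hfz hγ.le
    simp only [smul_eq_mul] at hfz'
    refine le_of_mul_le_mul_left ?_ ht
    linarith
  refine le_of_forall_pos_le_add fun ε hε => ?_
  have hD : 0 ≤ ‖v - p‖ ^ 2 / 2 := by positivity
  have hpos : 0 < ‖v - p‖ ^ 2 / 2 + 1 := by linarith
  set t := min 1 (ε / (‖v - p‖ ^ 2 / 2 + 1))
  have ht : 0 < t := lt_min one_pos (div_pos hε hpos)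
  have htε : t * (‖v - p‖ ^ 2 / 2 + 1) ≤ ε := (le_div_iff₀ hpos).1 (min_le_right _ _)
  linarith [key t ht (min_le_left _ _)]

/-- Two points satisfying the variational inequalities of the generalized projection
are at most as far apart as the points they are projected from. -/
theorem norm_sub_le_of_variational {f : H → ℝ} {γ : ℝ} {u v p q : H}
    (hp : ⟪u - p, q - p⟫ ≤ γ * (f q - f p)) (hq : ⟪v - q, p - q⟫ ≤ γ * (f p - f q)) :
    ‖p - q‖ ≤ ‖u - v‖ := by
  have hsum : ⟪u - p, q - p⟫ + ⟪v - q, p - q⟫ = ‖p - q‖ ^ 2 - ⟪u - v, p - q⟫ := by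
    rw [← real_inner_self_eq_norm_sq, ← neg_sub p q, inner_neg_right, ← sub_eq_neg_add,
      ← inner_sub_left, ← inner_sub_left]
    congr 1
    abel
  have hcs := real_inner_le_norm (u - v) (p - q)
  by_contra! h
  nlinarith [norm_nonneg (u - v)]

end GeneralizedProjection

theorem stmt_4
    {H : Type*} [NormedAddCommGroup H] [InnerProductSpace ℝ H] [CompleteSpace H]
    (K : Set H) (hKne : K.Nonempty) (hKcl : IsClosed K) (hKcv : Convex ℝ K)
    (f : H → ℝ) (hfcv : ConvexOn ℝ Set.univ f) (hflsc : LowerSemicontinuous f)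
    (γ : ℝ) (hγ : 0 < γ)
    (P : H → H)
    (hP : ∀ w : H, P w ∈ K ∧
      ∀ v ∈ K, γ * f (P w) + (1 / 2) * ‖w - P w‖ ^ 2 ≤ γ * f v + (1 / 2) * ‖w - v‖ ^ 2)
    (T g : H → H) (η lam β α : ℝ)
    (hT_lip : ∀ w v : H, ‖T w - T v‖ ≤ η * ‖w - v‖)
    (hT_mono : ∀ w v : H, ⟪T w - T v, w - v⟫ ≥ lam * ‖w - v‖ ^ 2)
    (hg_lip : ∀ w v : H, ‖g w - g v‖ ≤ β * ‖w - v‖)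
    (hcoupled : ∀ w v : H, ⟪T w - T v, g w - g v⟫ ≥ α * ‖w - v‖ ^ 2)
    (A : H → H) (hA : ∀ w : H, A w = T w - P (T w - γ • g w))
    (a : ℝ) (ha_def : a = lam + γ * α - η ^ 2 / 2 - γ ^ 2 * β ^ 2 / 2 - 1 / 2)
    (ha_pos : 0 < a) (a₁ : ℝ) (ha₁_def : a₁ = a / (2 * η + γ * β) ^ 2)
    (wstar : H)
    (hsol : T wstar ∈ K ∧ ∀ y ∈ K, ⟪g wstar, y - T wstar⟫ + f y - f (T wstar) ≥ 0) :
    ∀ w : H, ⟪w - wstar, A w⟫ ≥ a₁ * ‖A w‖ ^ 2 := by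
  have hVI : ∀ u, ∀ v ∈ K, ⟪u - P u, v - P u⟫ ≤ γ * (f v - f (P u)) := fun u v hv =>
    genProj_variational hKcv hfcv hγ (hP u).1 (hP u).2 hv
  have hPsol : P (T wstar - γ • g wstar) = T wstar := by
    set p := P (T wstar - γ • g wstar)
    have h := norm_sub_le_of_variational (v := T wstar - γ • g wstar) (q := T wstar)
      (hVI (T wstar - γ • g wstar) _ hsol.1) (by
        have h1 := mul_le_mul_of_nonneg_left (hsol.2 p (hP _).1) hγ.le
        rw [sub_sub_cancel_left, inner_neg_left, real_inner_smul_left]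
        linarith)
    rwa [sub_self, norm_zero, norm_le_zero_iff, sub_eq_zero] at h
  intro w
  set d := ‖w - wstar‖ with hd
  set u := T w - γ • g w with hu
  set x := T wstar - γ • g wstar with hx
  have hne : ‖P u - P x‖ ≤ ‖u - x‖ :=
    norm_sub_le_of_variational (hVI u _ (hP x).1) (hVI x _ (hP u).1)
  have hAw : A w = (T w - T wstar) - (P u - P x) := by
    rw [hA, hPsol]
    abel
  have hux : u - x = (T w - T wstar) - γ • (g w - g wstar) := by
    rw [hu, hx]
    module
  have hT := hT_lip w wstar
  have hg := hg_lip w wstar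
  have hT2 : ‖T w - T wstar‖ ^ 2 ≤ (η * d) ^ 2 := pow_le_pow_left₀ (norm_nonneg _) hT 2
  have hg2 : ‖g w - g wstar‖ ^ 2 ≤ (β * d) ^ 2 := pow_le_pow_left₀ (norm_nonneg _) hg 2
  have hux_sq : ‖u - x‖ ^ 2 ≤ (η ^ 2 - 2 * γ * α + γ ^ 2 * β ^ 2) * d ^ 2 := by
    rw [hux, norm_sub_sq_real, real_inner_smul_right, norm_smul, mul_pow, Real.norm_eq_abs,
      sq_abs]
    have h1 := mul_le_mul_of_nonneg_left (hcoupled w wstar) hγ.le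
    have h2 := mul_le_mul_of_nonneg_left hg2 (sq_nonneg γ)
    linarith
  have hlower : a * d ^ 2 ≤ ⟪w - wstar, A w⟫ := by
    rw [hAw, inner_sub_right, real_inner_comm]
    have h1 := real_inner_le_norm (w - wstar) (P u - P x)
    have h2 := mul_le_mul_of_nonneg_left hne (norm_nonneg (w - wstar))
    have h3 := hT_mono w wstar
    rw [← hd] at h1 h2 h3
    rw [ha_def]
    linarith [sq_nonneg (d - ‖u - x‖)]
  have hupper : ‖A w‖ ≤ (2 * η + γ * β) * d := by
    have h1 := norm_sub_le (T w - T wstar) (P u - P x)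
    have h2 := norm_sub_le (T w - T wstar) (γ • (g w - g wstar))
    rw [norm_smul, Real.norm_of_nonneg hγ.le] at h2
    rw [← hAw] at h1
    rw [← hux] at h2
    linarith [mul_le_mul_of_nonneg_left hg hγ.le]
  have hA2 : ‖A w‖ ^ 2 ≤ ((2 * η + γ * β) * d) ^ 2 := pow_le_pow_left₀ (norm_nonneg _) hupper 2
  refine le_trans ?_ hlower
  rw [ha₁_def]
  rcases eq_or_ne (2 * η + γ * β) 0 with h0 | h0
  · rw [h0]
    simp only [ne_eq, OfNat.ofNat_ne_zero, not_false_eq_true, zero_pow, div_zero, zero_mul]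
    positivity
  · have hc : 0 < (2 * η + γ * β) ^ 2 := by positivity
    rw [div_mul_eq_mul_div, div_le_iff₀ hc]
    linarith [mul_le_mul_of_nonneg_left hA2 ha_pos.le]
end

section
/- Let w* be a solution of the GIMVIP, and suppose a := λ + γα − η²/2 − γ²β²/2 − 1/2 > 0. Then for every w ∈ H, a‖w − w*‖ ≤ ‖A(w)‖. -/
open scoped RealInnerProductSpace

theorem inner_sub_le_of_isMinimizer
    {H : Type*} [NormedAddCommGroup H] [InnerProductSpace ℝ H]
    {K : Set H} (hK : Convex ℝ K) {f : H → ℝ} (hf : ConvexOn ℝ Set.univ f)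
    {γ : ℝ} (hγ : 0 < γ) {w x : H} (hx : x ∈ K)
    (hmin : ∀ v ∈ K, γ * f x + (1 / 2) * ‖w - x‖ ^ 2 ≤ γ * f v + (1 / 2) * ‖w - v‖ ^ 2)
    {v : H} (hv : v ∈ K) :
    ⟪w - x, v - x⟫ ≤ γ * (f v - f x) := by
  have key : ∀ t : ℝ, 0 < t → t ≤ 1 →
      ⟪w - x, v - x⟫ - γ * (f v - f x) ≤ t / 2 * ‖v - x‖ ^ 2 := by
    intro t ht ht1
    have hmem := hK hx hv (sub_nonneg.2 ht1) ht.le (sub_add_cancel 1 t)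
    have hfc := hf.2 (Set.mem_univ x) (Set.mem_univ v) (sub_nonneg.2 ht1) ht.le
      (sub_add_cancel 1 t)
    have hm := hmin _ hmem
    have hsub : w - ((1 - t) • x + t • v) = (w - x) - t • (v - x) := by module
    rw [hsub, norm_sub_sq_real (w - x), inner_smul_right, norm_smul, Real.norm_eq_abs,
      mul_pow, sq_abs] at hm
    simp only [smul_eq_mul] at hfc
    have hfc' := mul_le_mul_of_nonneg_left hfc hγ.le
    refine le_of_mul_le_mul_left ?_ ht
    linarith
  by_contra! hlt
  have hc : 0 < ⟪w - x, v - x⟫ - γ * (f v - f x) := sub_pos.2 hlt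
  set c := ⟪w - x, v - x⟫ - γ * (f v - f x)
  have hD : 0 ≤ ‖v - x‖ ^ 2 := by positivity
  set D := ‖v - x‖ ^ 2
  have hcD : 0 < c + D := by linarith
  have h := key (c / (c + D)) (by positivity) ((div_le_one hcD).2 (by linarith))
  have heq : c / (c + D) / 2 * D = c * D / (2 * (c + D)) := by field_simp
  rw [heq, le_div_iff₀ (by positivity)] at h
  nlinarith [mul_pos hc hc, mul_nonneg hc.le hD]

theorem stmt_5
    {H : Type*} [NormedAddCommGroup H] [InnerProductSpace ℝ H] [CompleteSpace H]
    (K : Set H) (hKne : K.Nonempty) (hKcl : IsClosed K) (hKcv : Convex ℝ K)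
    (f : H → ℝ) (hfcv : ConvexOn ℝ Set.univ f) (hflsc : LowerSemicontinuous f)
    (γ : ℝ) (hγ : 0 < γ)
    (P : H → H)
    (hP : ∀ w : H, P w ∈ K ∧
      ∀ v ∈ K, γ * f (P w) + (1 / 2) * ‖w - P w‖ ^ 2 ≤ γ * f v + (1 / 2) * ‖w - v‖ ^ 2)
    (T g : H → H) (η lam β α : ℝ)
    (hT_lip : ∀ w v : H, ‖T w - T v‖ ≤ η * ‖w - v‖)
    (hT_mono : ∀ w v : H, ⟪T w - T v, w - v⟫ ≥ lam * ‖w - v‖ ^ 2)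
    (hg_lip : ∀ w v : H, ‖g w - g v‖ ≤ β * ‖w - v‖)
    (hcoupled : ∀ w v : H, ⟪T w - T v, g w - g v⟫ ≥ α * ‖w - v‖ ^ 2)
    (A : H → H) (hA : ∀ w : H, A w = T w - P (T w - γ • g w))
    (a : ℝ) (ha_def : a = lam + γ * α - η ^ 2 / 2 - γ ^ 2 * β ^ 2 / 2 - 1 / 2)
    (ha_pos : 0 < a)
    (wstar : H)
    (hsol : T wstar ∈ K ∧ ∀ y ∈ K, ⟪g wstar, y - T wstar⟫ + f y - f (T wstar) ≥ 0) :
    ∀ w : H, a * ‖w - wstar‖ ≤ ‖A w‖ := by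
  intro w
  obtain ⟨hsK, hs⟩ := hsol
  set u := T w - γ • g w with hu
  obtain ⟨hPK, hPmin⟩ := hP u
  have h1 := inner_sub_le_of_isMinimizer hKcv hfcv hγ hPK hPmin hsK
  have h2 := mul_le_mul_of_nonneg_left (hs _ hPK) hγ.le
  set t := T w - T wstar with ht
  set e := g w - g wstar with he
  set d := w - wstar with hd
  set q := P u - T wstar with hq
  have hAw : A w = t - q := by rw [hA, ht, hq, ← hu]; abel
  have hup : u - P u = (t - γ • e - q) - γ • g wstar := by
    rw [hu, ht, he, hq]; module
  have hneg : T wstar - P u = -q := by rw [hq]; abel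
  rw [hup, hneg, inner_neg_right, inner_sub_left, inner_sub_left, real_inner_smul_left,
    real_inner_self_eq_norm_sq] at h1
  have hqsq : ‖q‖ ^ 2 ≤ ⟪t - γ • e, q⟫ := by linarith
  have hqn : ‖q‖ ^ 2 ≤ ‖t - γ • e‖ ^ 2 := by
    have := norm_sub_sq_real (t - γ • e) q
    nlinarith [sq_nonneg ‖t - γ • e - q‖]
  have hexp : ‖t - γ • e‖ ^ 2 = ‖t‖ ^ 2 - 2 * (γ * ⟪t, e⟫) + γ ^ 2 * ‖e‖ ^ 2 := by
    rw [norm_sub_sq_real, inner_smul_right, norm_smul, mul_pow, Real.norm_eq_abs, sq_abs]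
  have htsq : ‖t‖ ^ 2 ≤ η ^ 2 * ‖d‖ ^ 2 := by
    rw [← mul_pow]; exact pow_le_pow_left₀ (norm_nonneg _) (hT_lip w wstar) 2
  have hesq : γ ^ 2 * ‖e‖ ^ 2 ≤ γ ^ 2 * (β ^ 2 * ‖d‖ ^ 2) := by
    rw [← mul_pow β]
    exact mul_le_mul_of_nonneg_left
      (pow_le_pow_left₀ (norm_nonneg _) (hg_lip w wstar) 2) (sq_nonneg γ)
  have hco : γ * (α * ‖d‖ ^ 2) ≤ γ * ⟪t, e⟫ :=
    mul_le_mul_of_nonneg_left (hcoupled w wstar) hγ.le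
  have hmono : lam * ‖d‖ ^ 2 ≤ ⟪t, d⟫ := hT_mono w wstar
  have hqd : 2 * ⟪q, d⟫ ≤ ‖q‖ ^ 2 + ‖d‖ ^ 2 := by
    have := norm_sub_sq_real q d
    nlinarith [sq_nonneg ‖q - d‖]
  have hcs : ⟪t - q, d⟫ ≤ ‖t - q‖ * ‖d‖ := real_inner_le_norm _ _
  rw [inner_sub_left] at hcs
  have hmain : a * ‖d‖ * ‖d‖ ≤ ‖t - q‖ * ‖d‖ := by
    rw [ha_def]; linarith
  rw [hAw]
  rcases (norm_nonneg d).eq_or_lt with h0 | hpos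
  · rw [← h0, mul_zero]; exact norm_nonneg _
  · exact le_of_mul_le_mul_right hmain hpos
end

section
/- Let w* be a solution of the GIMVIP, and suppose a := λ + γα − η²/2 − γ²β²/2 − 1/2 > 0. Then for every w ∈ H, ⟨−A(w), w − w*⟩ ≤ −a‖w − w*‖². -/
open scoped RealInnerProductSpace

/-- The variational inequality satisfied by a minimizer `p` over `K` of the proximal functional
`v ↦ γ * f v + (1 / 2) * ‖u - v‖ ^ 2`. -/
theorem inner_sub_le_of_prox_minimizer
    {H : Type*} [NormedAddCommGroup H] [InnerProductSpace ℝ H]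
    {K : Set H} (hK : Convex ℝ K) {f : H → ℝ} (hf : ConvexOn ℝ K f)
    {γ : ℝ} (hγ : 0 ≤ γ) {u p : H} (hp : p ∈ K)
    (hmin : ∀ v ∈ K, γ * f p + (1 / 2) * ‖u - p‖ ^ 2 ≤ γ * f v + (1 / 2) * ‖u - v‖ ^ 2)
    {v : H} (hv : v ∈ K) :
    ⟪u - p, v - p⟫ ≤ γ * (f v - f p) := by
  have key : ∀ t : ℝ, 0 < t → t ≤ 1 →
      0 ≤ γ * (f v - f p) - ⟪u - p, v - p⟫ + t / 2 * ‖v - p‖ ^ 2 := by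
    intro t ht ht1
    have hmem : (1 - t) • p + t • v ∈ K := hK hp hv (by linarith) ht.le (by ring)
    have hconv := hf.2 hp hv (sub_nonneg.2 ht1) ht.le (by ring)
    simp only [smul_eq_mul] at hconv
    have hle := hmin _ hmem
    have hsub : u - ((1 - t) • p + t • v) = (u - p) - t • (v - p) := by module
    rw [hsub, norm_sub_sq_real (u - p), inner_smul_right, norm_smul, mul_pow, Real.norm_eq_abs,
      sq_abs] at hle
    have hconv' := mul_le_mul_of_nonneg_left hconv hγ
    refine nonneg_of_mul_nonneg_right (a := t) ?_ ht
    linarith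
  by_contra! hlt
  set c := ⟪u - p, v - p⟫ - γ * (f v - f p) with hc
  have hc0 : 0 < c := sub_pos.2 hlt
  have hN : 0 ≤ ‖v - p‖ ^ 2 := sq_nonneg _
  have hden : 0 < c + ‖v - p‖ ^ 2 := by linarith
  have h := key (c / (c + ‖v - p‖ ^ 2)) (div_pos hc0 hden) ((div_le_one hden).2 (by linarith))
  have hbound : c / (c + ‖v - p‖ ^ 2) * ‖v - p‖ ^ 2 ≤ c := by
    rw [div_mul_eq_mul_div, div_le_iff₀ hden]
    nlinarith
  linarith

theorem stmt_6
    {H : Type*} [NormedAddCommGroup H] [InnerProductSpace ℝ H] [CompleteSpace H]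
    (K : Set H) (hKne : K.Nonempty) (hKcl : IsClosed K) (hKcv : Convex ℝ K)
    (f : H → ℝ) (hfcv : ConvexOn ℝ Set.univ f) (hflsc : LowerSemicontinuous f)
    (γ : ℝ) (hγ : 0 < γ)
    (P : H → H)
    (hP : ∀ w : H, P w ∈ K ∧
      ∀ v ∈ K, γ * f (P w) + (1 / 2) * ‖w - P w‖ ^ 2 ≤ γ * f v + (1 / 2) * ‖w - v‖ ^ 2)
    (T g : H → H) (η lam β α : ℝ)
    (hT_lip : ∀ w v : H, ‖T w - T v‖ ≤ η * ‖w - v‖)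
    (hT_mono : ∀ w v : H, ⟪T w - T v, w - v⟫ ≥ lam * ‖w - v‖ ^ 2)
    (hg_lip : ∀ w v : H, ‖g w - g v‖ ≤ β * ‖w - v‖)
    (hcoupled : ∀ w v : H, ⟪T w - T v, g w - g v⟫ ≥ α * ‖w - v‖ ^ 2)
    (A : H → H) (hA : ∀ w : H, A w = T w - P (T w - γ • g w))
    (a : ℝ) (ha_def : a = lam + γ * α - η ^ 2 / 2 - γ ^ 2 * β ^ 2 / 2 - 1 / 2)
    (ha_pos : 0 < a)
    (wstar : H)
    (hsol : T wstar ∈ K ∧ ∀ y ∈ K, ⟪g wstar, y - T wstar⟫ + f y - f (T wstar) ≥ 0) :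
    ∀ w : H, ⟪-A w, w - wstar⟫ ≤ -a * ‖w - wstar‖ ^ 2 := by
  intro w
  obtain ⟨hqK, hq⟩ := hsol
  obtain ⟨hpK, hmin⟩ := hP (T w - γ • g w)
  have hvi := inner_sub_le_of_prox_minimizer hKcv
    (hfcv.subset (Set.subset_univ K) hKcv) hγ.le hpK hmin hqK
  rw [hA]
  set p := P (T w - γ • g w)
  have hsol_p := mul_nonneg hγ.le (hq p hpK)
  have hfirm : ‖p - T wstar‖ ^ 2 ≤
      ⟪(T w - T wstar) - γ • (g w - g wstar), p - T wstar⟫ := by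
    have hsplit : (T w - T wstar) - γ • (g w - g wstar) =
        (T w - γ • g w - p) + (p - T wstar) + γ • g wstar := by module
    have hneg : T wstar - p = -(p - T wstar) := by abel
    rw [hneg, inner_neg_right] at hvi
    rw [hsplit, inner_add_left, inner_add_left, real_inner_self_eq_norm_sq, real_inner_smul_left]
    linarith
  have hnonexp : ‖p - T wstar‖ ^ 2 ≤ ‖(T w - T wstar) - γ • (g w - g wstar)‖ ^ 2 := by
    have h := norm_sub_sq_real ((T w - T wstar) - γ • (g w - g wstar)) (p - T wstar)
    linarith [sq_nonneg ‖(T w - T wstar) - γ • (g w - g wstar) - (p - T wstar)‖]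
  rw [norm_sub_sq_real (T w - T wstar), inner_smul_right, norm_smul, mul_pow, Real.norm_eq_abs,
    sq_abs] at hnonexp
  have hT := pow_le_pow_left₀ (norm_nonneg _) (hT_lip w wstar) 2
  have hg := mul_le_mul_of_nonneg_left
    (pow_le_pow_left₀ (norm_nonneg _) (hg_lip w wstar) 2) (sq_nonneg γ)
  have hTg := mul_le_mul_of_nonneg_left (hcoupled w wstar) hγ.le
  have hyoung := norm_sub_sq_real (p - T wstar) (w - wstar)
  have hA_split : -(T w - p) = (p - T wstar) - (T w - T wstar) := by abel
  rw [hA_split, inner_sub_left, ha_def]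
  linarith [hT_mono w wstar, sq_nonneg ‖p - T wstar - (w - wstar)‖]
end

section
/- Suppose g is β-Lipschitz continuous and ζ-strongly monotone on H (⟨g(w) − g(v), w − v⟩ ≥ ζ‖w − v‖² for all w, v), T is η-Lipschitz continuous, the pair (T, g) is α-strongly coupled monotone on H, and √(η² + β² − 2α) + √(1 − 2ζ + β²) < 1, where α < (β² + η²)/2 and ζ < (1 + β²)/2. Then the GIMVIP has a unique solution: there exists exactly one w* ∈ H with T(w*) ∈ K and ⟨g(w*), y − T(w*)⟩ + f(y) − f(T(w*)) ≥ 0 for all y ∈ K. -/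
open scoped RealInnerProductSpace

open Filter Topology

section Prox

variable {H : Type*} [NormedAddCommGroup H] [InnerProductSpace ℝ H]

/-- A lower semicontinuous convex function decreases at most linearly. -/
lemma ConvexOn.exists_linear_minorant {f : H → ℝ} (hf : ConvexOn ℝ Set.univ f)
    (hlsc : LowerSemicontinuous f) (x : H) :
    ∃ c : ℝ, ∀ y, f x - 1 - c * ‖y - x‖ ≤ f y := by
  obtain ⟨δ, hδ, hball⟩ := Metric.eventually_nhds_iff.1 (hlsc x (f x - 1) (by linarith))
  have hδ2 : 0 < δ / 2 := by linarith
  refine ⟨(δ / 2)⁻¹, fun y => ?_⟩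
  rcases lt_or_ge ‖y - x‖ δ with h | h
  · have h1 := hball (y := y) (by rwa [dist_eq_norm])
    have h2 : 0 ≤ (δ / 2)⁻¹ * ‖y - x‖ := by positivity
    linarith
  · have hr : 0 < ‖y - x‖ := by linarith
    set t := δ / 2 / ‖y - x‖ with ht
    have ht0 : 0 < t := by positivity
    have ht1 : t ≤ 1 := by rw [ht, div_le_one hr]; linarith
    have h1 := hball (y := (1 - t) • x + t • y) (by
      have : (1 - t) • x + t • y - x = t • (y - x) := by module
      rw [dist_eq_norm, this, norm_smul, Real.norm_of_nonneg ht0.le, ht,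
        div_mul_cancel₀ _ hr.ne']
      linarith)
    have h2 := hf.2 (Set.mem_univ x) (Set.mem_univ y) (sub_nonneg.2 ht1) ht0.le (by ring)
    simp only [smul_eq_mul] at h2
    have h3 : t * ((δ / 2)⁻¹ * ‖y - x‖) = 1 := by rw [ht]; field_simp
    have h4 : 0 < t * (f y - (f x - (δ / 2)⁻¹ * ‖y - x‖)) := by
      rw [mul_sub, mul_sub, h3]; linarith
    have := (mul_pos_iff_of_pos_left ht0).1 h4
    linarith

/-- The point `p` is the proximal point of `x` for `f` on `K`, in variational form. -/
def IsProx (K : Set H) (f : H → ℝ) (x p : H) : Prop :=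
  p ∈ K ∧ ∀ y ∈ K, 0 ≤ ⟪p - x, y - p⟫ + f y - f p

lemma IsProx.norm_sq_le_inner {K : Set H} {f : H → ℝ} {x x' p p' : H}
    (h : IsProx K f x p) (h' : IsProx K f x' p') :
    ‖p - p'‖ ^ 2 ≤ ⟪x - x', p - p'⟫ := by
  have h1 := h.2 _ h'.1
  have h2 := h'.2 _ h.1
  have h3 : ⟪p - x, p' - p⟫ + ⟪p' - x', p - p'⟫ = ⟪x - x', p - p'⟫ - ‖p - p'‖ ^ 2 := by
    rw [← real_inner_self_eq_norm_sq, ← neg_sub p p', inner_neg_right, neg_add_eq_sub,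
      ← inner_sub_left, ← inner_sub_left]
    congr 1
    abel
  linarith

lemma IsProx.eq {K : Set H} {f : H → ℝ} {x p p' : H}
    (h : IsProx K f x p) (h' : IsProx K f x p') : p = p' := by
  have := h.norm_sq_le_inner h'
  rw [sub_self, inner_zero_left] at this
  exact sub_eq_zero.1 (norm_eq_zero.1 (pow_eq_zero_iff two_ne_zero |>.1
    (le_antisymm this (by positivity))))

lemma IsProx.norm_residual_sub_le {K : Set H} {f : H → ℝ} {x x' p p' : H}
    (h : IsProx K f x p) (h' : IsProx K f x' p') :
    ‖(x - p) - (x' - p')‖ ≤ ‖x - x'‖ := by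
  have h1 := h.norm_sq_le_inner h'
  have h2 : (x - p) - (x' - p') = (x - x') - (p - p') := by abel
  refine (sq_le_sq₀ (norm_nonneg _) (norm_nonneg _)).1 ?_
  rw [h2, norm_sub_sq_real]
  nlinarith [sq_nonneg ‖p - p'‖]

lemma exists_minimizer_add_half_norm_sq [CompleteSpace H] {K : Set H} (hKne : K.Nonempty)
    (hKcl : IsClosed K) (hKcv : Convex ℝ K) {f : H → ℝ} (hf : ConvexOn ℝ Set.univ f)
    (hlsc : LowerSemicontinuous f) (x : H) :
    ∃ p ∈ K, ∀ y ∈ K, f p + ‖p - x‖ ^ 2 / 2 ≤ f y + ‖y - x‖ ^ 2 / 2 := by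
  set φ : H → ℝ := fun y => f y + ‖y - x‖ ^ 2 / 2 with hφ
  have hφlsc : LowerSemicontinuous φ :=
    hlsc.add (Continuous.lowerSemicontinuous (by fun_prop))
  have hbdd : BddBelow (φ '' K) := by
    obtain ⟨c, hc⟩ := hf.exists_linear_minorant hlsc x
    refine ⟨f x - 1 - c ^ 2 / 2, ?_⟩
    rintro _ ⟨y, -, rfl⟩
    have := hc y
    simp only [hφ]
    nlinarith [sq_nonneg (‖y - x‖ - c)]
  set m := sInf (φ '' K) with hm
  have hle : ∀ y ∈ K, m ≤ φ y := fun y hy => csInf_le hbdd ⟨y, hy, rfl⟩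
  have hmid : ∀ a ∈ K, ∀ b ∈ K, ‖a - b‖ ^ 2 ≤ 4 * (φ a + φ b - 2 * m) := by
    intro a ha b hb
    have h1 := hle _ (hKcv ha hb (a := 1 / 2) (b := 1 / 2) (by norm_num) (by norm_num)
      (by norm_num))
    have h2 := hf.2 (Set.mem_univ a) (Set.mem_univ b) (by norm_num : (0 : ℝ) ≤ 1 / 2)
      (by norm_num : (0 : ℝ) ≤ 1 / 2) (by norm_num)
    have h3 := parallelogram_law_with_norm ℝ (a - x) (b - x)
    have h4 : a - x - (b - x) = a - b := by abel
    have h5 : (1 / 2 : ℝ) • a + (1 / 2 : ℝ) • b - x = (1 / 2 : ℝ) • (a - x + (b - x)) := by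
      module
    simp only [hφ, h5, norm_smul, smul_eq_mul] at h1 h2 ⊢
    rw [h4] at h3
    norm_num at h1 h2
    nlinarith
  have hseq : ∀ n : ℕ, ∃ y ∈ K, φ y < m + 1 / ((n : ℝ) + 1) := by
    intro n
    obtain ⟨_, ⟨y, hy, rfl⟩, h⟩ := exists_lt_of_csInf_lt (hKne.image φ)
      (show sInf (φ '' K) < m + 1 / ((n : ℝ) + 1) from
        lt_add_of_pos_right _ Nat.one_div_pos_of_nat)
    exact ⟨y, hy, h⟩
  choose u huK hu using hseq
  have hcauchy : CauchySeq u := by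
    refine cauchySeq_of_le_tendsto_0 (fun N : ℕ => Real.sqrt (8 * (1 / ((N : ℝ) + 1)))) ?_ ?_
    · intro i j N hi hj
      rw [dist_eq_norm]
      apply Real.le_sqrt_of_sq_le
      have h1 := hmid _ (huK i) _ (huK j)
      have h2 := hu i
      have h3 := hu j
      have h4 := Nat.one_div_le_one_div (α := ℝ) hi
      have h5 := Nat.one_div_le_one_div (α := ℝ) hj
      linarith
    · have := (tendsto_one_div_add_atTop_nhds_zero_nat (𝕜 := ℝ)).const_mul 8
      simpa using this.sqrt
  obtain ⟨p, hp⟩ := cauchySeq_tendsto_of_complete hcauchy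
  refine ⟨p, hKcl.mem_of_tendsto hp (Eventually.of_forall huK), fun y hy => ?_⟩
  refine le_trans (le_of_forall_lt fun c hc => ?_) (hle y hy)
  obtain ⟨c', hcc', hc'⟩ := exists_between hc
  refine hcc'.trans_le ?_
  have hlim : Tendsto (fun n : ℕ => m + 1 / ((n : ℝ) + 1)) atTop (𝓝 (m + 0)) :=
    tendsto_one_div_add_atTop_nhds_zero_nat.const_add m
  rw [add_zero] at hlim
  refine ge_of_tendsto hlim ?_
  filter_upwards [hp.eventually (hφlsc p c' hc')] with n hn
  exact (hn.trans (hu n)).le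

lemma exists_isProx [CompleteSpace H] {K : Set H} (hKne : K.Nonempty)
    (hKcl : IsClosed K) (hKcv : Convex ℝ K) {f : H → ℝ} (hf : ConvexOn ℝ Set.univ f)
    (hlsc : LowerSemicontinuous f) (x : H) : ∃ p, IsProx K f x p := by
  obtain ⟨p, hpK, hp⟩ := exists_minimizer_add_half_norm_sq hKne hKcl hKcv hf hlsc x
  refine ⟨p, hpK, fun y hy => ?_⟩
  have hlim : Tendsto (fun t : ℝ => ⟪p - x, y - p⟫ + f y - f p + t * (‖y - p‖ ^ 2 / 2))
      (𝓝[>] 0) (𝓝 (⟪p - x, y - p⟫ + f y - f p)) := by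
    have : Continuous (fun t : ℝ => ⟪p - x, y - p⟫ + f y - f p + t * (‖y - p‖ ^ 2 / 2)) := by
      fun_prop
    simpa using (this.tendsto 0).mono_left nhdsWithin_le_nhds
  refine ge_of_tendsto hlim ?_
  filter_upwards [Ioc_mem_nhdsGT (zero_lt_one (α := ℝ))] with t ht
  have h1 := hp _ (hKcv hpK hy (sub_nonneg.2 ht.2) ht.1.le (by ring))
  have h2 := hf.2 (Set.mem_univ p) (Set.mem_univ y) (sub_nonneg.2 ht.2) ht.1.le (by ring)
  have h3 : (1 - t) • p + t • y - x = (p - x) + t • (y - p) := by module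
  rw [h3, norm_add_sq_real, inner_smul_right, norm_smul, Real.norm_of_nonneg ht.1.le] at h1
  simp only [smul_eq_mul] at h2
  have h4 : 0 ≤ t * (⟪p - x, y - p⟫ + f y - f p + t * (‖y - p‖ ^ 2 / 2)) := by nlinarith
  exact nonneg_of_mul_nonneg_right h4 ht.1

lemma norm_sub_le_sqrt_mul {a b : H} {A B c r : ℝ} (ha : ‖a‖ ≤ A * r) (hb : ‖b‖ ≤ B * r)
    (hab : c * r ^ 2 ≤ ⟪a, b⟫) (hr : 0 ≤ r) :
    ‖a - b‖ ≤ Real.sqrt (A ^ 2 + B ^ 2 - 2 * c) * r := by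
  have h1 := pow_le_pow_left₀ (norm_nonneg a) ha 2
  have h2 := pow_le_pow_left₀ (norm_nonneg b) hb 2
  rw [← Real.sqrt_sq hr, ← Real.sqrt_mul' _ (sq_nonneg r)]
  apply Real.le_sqrt_of_sq_le
  rw [norm_sub_sq_real]
  nlinarith

end Prox

/-- Existence and uniqueness of the solution of the GIMVIP. -/
theorem stmt_7
    {H : Type*} [NormedAddCommGroup H] [InnerProductSpace ℝ H] [CompleteSpace H]
    (K : Set H) (hKne : K.Nonempty) (hKcl : IsClosed K) (hKcv : Convex ℝ K)
    (f : H → ℝ) (hfcv : ConvexOn ℝ Set.univ f) (hflsc : LowerSemicontinuous f)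
    (T g : H → H) (η β ζ α : ℝ)
    (hT_lip : ∀ w v : H, ‖T w - T v‖ ≤ η * ‖w - v‖)
    (hg_lip : ∀ w v : H, ‖g w - g v‖ ≤ β * ‖w - v‖)
    (hg_mono : ∀ w v : H, ⟪g w - g v, w - v⟫ ≥ ζ * ‖w - v‖ ^ 2)
    (hcoupled : ∀ w v : H, ⟪T w - T v, g w - g v⟫ ≥ α * ‖w - v‖ ^ 2)
    (hcond : Real.sqrt (η ^ 2 + β ^ 2 - 2 * α) + Real.sqrt (1 - 2 * ζ + β ^ 2) < 1)
    (hα : α < (β ^ 2 + η ^ 2) / 2) (hζ : ζ < (1 + β ^ 2) / 2) :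
    ∃! wstar : H, T wstar ∈ K ∧
      ∀ y ∈ K, ⟪g wstar, y - T wstar⟫ + f y - f (T wstar) ≥ 0 := by
  choose P hP using exists_isProx hKne hKcl hKcv hfcv hflsc
  have hsol : ∀ w, (T w ∈ K ∧ ∀ y ∈ K, ⟪g w, y - T w⟫ + f y - f (T w) ≥ 0) ↔
      IsProx K f (T w - g w) (T w) := by
    intro w
    simp only [IsProx, sub_sub_cancel, ge_iff_le]
  set Φ : H → H := fun w => w - T w + P (T w - g w) with hΦ
  have hfix : ∀ w, IsProx K f (T w - g w) (T w) ↔ Φ w = w := by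
    intro w
    have : Φ w = w ↔ T w = P (T w - g w) := by
      simp only [hΦ, sub_add, sub_eq_self, sub_eq_zero]
    rw [this]
    exact ⟨fun h => h.eq (hP _), fun h => by simpa only [← h] using hP (T w - g w)⟩
  set q := Real.sqrt (η ^ 2 + β ^ 2 - 2 * α) + Real.sqrt (1 - 2 * ζ + β ^ 2) with hq
  have hq0 : 0 ≤ q := by positivity
  have hlip : ∀ w v, dist (Φ w) (Φ v) ≤ q * dist w v := by
    intro w v
    have h1 := norm_sub_le_sqrt_mul (hT_lip w v) (hg_lip w v) (hcoupled w v) (norm_nonneg _)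
    have h2 := norm_sub_le_sqrt_mul (a := w - v) (A := 1) (by rw [one_mul]) (hg_lip w v)
      (by rw [real_inner_comm]; exact hg_mono w v) (norm_nonneg _)
    have h3 := (hP (T w - g w)).norm_residual_sub_le (hP (T v - g v))
    have h4 : Φ w - Φ v = (w - v - (g w - g v)) -
        ((T w - g w - P (T w - g w)) - (T v - g v - P (T v - g v))) := by
      simp only [hΦ]; abel
    have h5 : T w - g w - (T v - g v) = T w - T v - (g w - g v) := by abel
    have h6 : (1 : ℝ) ^ 2 + β ^ 2 - 2 * ζ = 1 - 2 * ζ + β ^ 2 := by ring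
    rw [h5] at h3
    rw [h6] at h2
    rw [dist_eq_norm, dist_eq_norm, h4, hq, add_mul]
    refine (norm_sub_le _ _).trans ?_
    linarith
  have hcontr : ContractingWith ⟨q, hq0⟩ Φ :=
    ⟨by exact_mod_cast hcond, LipschitzWith.of_dist_le_mul hlip⟩
  simp only [hsol, hfix]
  exact ⟨hcontr.fixedPoint, hcontr.fixedPoint_isFixedPt, fun w hw => hcontr.fixedPoint_unique hw⟩
end

section
/- Suppose a := λ + γα − η²/2 − γ²β²/2 − 1/2 > 0, set a₁ := a/(2η + γβ)², and let w* be a solution of the GIMVIP. Let κ, ρ : [0, ∞) → (0, ∞) be differentiable and suppose there is a constant κ̲ such that for all t ≥ 0: (i) 1 < κ̲ ≤ κ(t) ≤ a²·a₁·ρ(t) + 1; (ii) κ'(t) ≤ 0 and the function t ↦ κ(t)/ρ(t) has nonpositive derivative; (iii) κ(t)² − κ(t) − 2ρ(t)/a₁ ≥ 0. Let w : ℝ → H be twice differentiable on [0, ∞) and satisfy w''(t) + κ(t)·w'(t) + ρ(t)·A(w(t)) = 0 for all t ≥ 0. Then w(t) converges exponentially to w*: there exist constants C > 0 and δ > 0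 such that ‖w(t) − w*‖ ≤ C·e^{−δt} for all t ≥ 0. -/
open scoped RealInnerProductSpace

/-- The variational inequality characterizing a generalized `f`-projection `p` of `x` onto `K`. -/
theorem inner_le_of_isMin_prox {H : Type*} [NormedAddCommGroup H] [InnerProductSpace ℝ H]
    {K : Set H} (hK : Convex ℝ K) {f : H → ℝ} (hf : ConvexOn ℝ Set.univ f) {γ : ℝ} (hγ : 0 ≤ γ)
    {x p : H} (hp : p ∈ K)
    (hmin : ∀ v ∈ K, γ * f p + (1 / 2) * ‖x - p‖ ^ 2 ≤ γ * f v + (1 / 2) * ‖x - v‖ ^ 2)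
    {v : H} (hv : v ∈ K) : ⟪x - p, v - p⟫ ≤ γ * (f v - f p) := by
  have key : ∀ t : ℝ, 0 < t → t ≤ 1 →
      ⟪x - p, v - p⟫ - γ * (f v - f p) ≤ t * (‖v - p‖ ^ 2 / 2) := by
    intro t ht ht1
    have hm := hmin _ (hK hp hv (sub_nonneg.2 ht1) ht.le (by ring))
    have hc := mul_le_mul_of_nonneg_left
      (hf.2 (Set.mem_univ p) (Set.mem_univ v) (sub_nonneg.2 ht1) ht.le (by ring)) hγ
    have he : x - ((1 - t) • p + t • v) = (x - p) - t • (v - p) := by module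
    rw [he, norm_sub_sq_real (x - p), inner_smul_right, norm_smul, mul_pow, Real.norm_eq_abs, sq_abs] at hm
    simp only [smul_eq_mul] at hc
    refine le_of_mul_le_mul_left ?_ ht
    linarith
  have hlim : Filter.Tendsto (fun t : ℝ => t * (‖v - p‖ ^ 2 / 2)) (nhdsWithin 0 (Set.Ioi 0))
      (nhds 0) := by
    have : Continuous fun t : ℝ => t * (‖v - p‖ ^ 2 / 2) := by fun_prop
    simpa using (this.tendsto 0).mono_left nhdsWithin_le_nhds
  refine sub_nonpos.1 (ge_of_tendsto hlim ?_)
  filter_upwards [Ioc_mem_nhdsGT (zero_lt_one' ℝ)] with t ht using key t ht.1 ht.2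

/-- A map whose values are characterized by the variational inequality of the generalized
`f`-projection is nonexpansive. -/
theorem norm_sub_le_of_prox_inner_le {H : Type*} [NormedAddCommGroup H] [InnerProductSpace ℝ H]
    {x y p q : H} {c : ℝ} (hp : ⟪x - p, q - p⟫ ≤ c) (hq : ⟪y - q, p - q⟫ ≤ -c) :
    ‖p - q‖ ≤ ‖x - y‖ := by
  have h1 : ‖p - q‖ ^ 2 ≤ ⟪x - y, p - q⟫ := by
    have e : ⟪x - p, q - p⟫ + ⟪y - q, p - q⟫ = ‖p - q‖ ^ 2 - ⟪x - y, p - q⟫ := by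
      rw [← real_inner_self_eq_norm_sq]
      simp only [inner_sub_left, inner_sub_right]
      ring
    linarith
  have h2 := h1.trans (real_inner_le_norm _ _)
  by_contra! hlt
  nlinarith [norm_nonneg (x - y)]

theorem le_apply_zero_of_hasDerivAt_nonpos {F F' : ℝ → ℝ}
    (hF : ∀ t ≥ (0 : ℝ), HasDerivAt F (F' t) t) (hF' : ∀ t ≥ (0 : ℝ), F' t ≤ 0)
    {t : ℝ} (ht : 0 ≤ t) : F t ≤ F 0 := by
  refine antitoneOn_of_deriv_nonpos (convex_Ici (0 : ℝ))
    (fun s hs => (hF s hs).continuousAt.continuousWithinAt)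
    (fun s hs => (hF s (interior_subset hs)).differentiableAt.differentiableWithinAt)
    (fun s hs => ?_) Set.self_mem_Ici ht ht
  rw [(hF s (interior_subset hs)).deriv]
  exact hF' s (interior_subset hs)

/-- A nonnegative function with `h' + μ h ≤ M e⁻ᵗ` for some `μ > 0` decays exponentially. -/
theorem exists_exp_bound_of_deriv_add_mul_le {h h' : ℝ → ℝ} {μ M : ℝ} (hμ : 0 < μ)
    (hh : ∀ t ≥ (0 : ℝ), HasDerivAt h (h' t) t) (hnn : ∀ t, 0 ≤ h t)
    (hle : ∀ t ≥ (0 : ℝ), h' t + μ * h t ≤ M * Real.exp (-t)) :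
    ∃ C > (0 : ℝ), ∃ c > (0 : ℝ), ∀ t ≥ (0 : ℝ), h t ≤ C * Real.exp (-c * t) := by
  obtain ⟨c, hc0, hcμ, hc2⟩ : ∃ c : ℝ, 0 < c ∧ c ≤ μ ∧ c ≤ 1 / 2 :=
    ⟨min μ (1 / 2), lt_min hμ (by norm_num), min_le_left _ _, min_le_right _ _⟩
  refine ⟨h 0 + 2 * |M| + 1, by have := hnn 0; positivity, c, hc0, fun t ht => ?_⟩
  have hexp (k s : ℝ) : HasDerivAt (fun s => Real.exp (k * s)) (Real.exp (k * s) * k) s := by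
    simpa using ((hasDerivAt_id s).const_mul k).exp
  have hmono := le_apply_zero_of_hasDerivAt_nonpos
    (F := fun s => Real.exp (c * s) * h s + 2 * |M| * Real.exp (-(1 / 2) * s))
    (fun s hs => ((hexp c s).mul (hh s hs)).add ((hexp (-(1 / 2)) s).const_mul (2 * |M|)))
    (fun s hs => by
      have h1 : h' s + c * h s ≤ |M| * Real.exp (-s) := by
        have := mul_le_mul_of_nonneg_right hcμ (hnn s)
        have := mul_le_mul_of_nonneg_right (le_abs_self M) (Real.exp_pos (-s)).le
        linarith [hle s hs]
      have h2 := mul_le_mul_of_nonneg_left h1 (Real.exp_pos (c * s)).le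
      have h3 : Real.exp (c * s) * Real.exp (-s) ≤ Real.exp (-(1 / 2) * s) := by
        rw [← Real.exp_add]
        exact Real.exp_le_exp.2 (by nlinarith)
      have h4 := mul_le_mul_of_nonneg_left h3 (abs_nonneg M)
      linarith) ht
  simp only [mul_zero, Real.exp_zero, one_mul, mul_one] at hmono
  have hb : Real.exp (c * t) * h t ≤ h 0 + 2 * |M| + 1 := by
    have : 0 ≤ 2 * |M| * Real.exp (-(1 / 2) * t) := by positivity
    linarith
  have := mul_le_mul_of_nonneg_right hb (Real.exp_pos (-c * t)).le
  rwa [mul_right_comm, ← Real.exp_add, show c * t + -c * t = 0 by ring, Real.exp_zero,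
    one_mul] at this

/-- Exponential decay along `w'' + κ w' + ρ A(w) = 0` when `A` is `a`-strongly monotone and
`a₁`-cocoercive with respect to `z`. -/
theorem exists_exp_bound_of_second_order_ode
    {H : Type*} [NormedAddCommGroup H] [InnerProductSpace ℝ H] {A : H → H} {z : H} {a a₁ : ℝ}
    (ha₁ : 0 < a₁) (hmono : ∀ x, a * ‖x - z‖ ^ 2 ≤ ⟪A x, x - z⟫)
    (hcoco : ∀ x, a₁ * ‖A x‖ ^ 2 ≤ ⟪A x, x - z⟫)
    {κ ρ : ℝ → ℝ} (hκpos : ∀ t ≥ (0 : ℝ), 0 < κ t) (hρpos : ∀ t ≥ (0 : ℝ), 0 < ρ t)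
    (hκdiff : ∀ t ≥ (0 : ℝ), DifferentiableAt ℝ κ t)
    (hρdiff : ∀ t ≥ (0 : ℝ), DifferentiableAt ℝ ρ t)
    {κlow : ℝ} (hκlow : 1 < κlow) (hκge : ∀ t ≥ (0 : ℝ), κlow ≤ κ t)
    (hκle : ∀ t ≥ (0 : ℝ), κ t ≤ a * ρ t + 1)
    (hκ' : ∀ t ≥ (0 : ℝ), deriv κ t ≤ 0)
    (hκρ' : ∀ t ≥ (0 : ℝ), deriv (fun s => κ s / ρ s) t ≤ 0)
    (hκρ : ∀ t ≥ (0 : ℝ), κ t ^ 2 - κ t - 2 * ρ t / a₁ ≥ 0)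
    {w : ℝ → H} (hw₁ : ∀ t ≥ (0 : ℝ), DifferentiableAt ℝ w t)
    (hw₂ : ∀ t ≥ (0 : ℝ), DifferentiableAt ℝ (deriv w) t)
    (hode : ∀ t ≥ (0 : ℝ), deriv (deriv w) t + κ t • deriv w t + ρ t • A (w t) = 0) :
    ∃ C > (0 : ℝ), ∃ δ > (0 : ℝ), ∀ t ≥ (0 : ℝ), ‖w t - z‖ ≤ C * Real.exp (-δ * t) := by
  have hu (t : ℝ) (ht : t ≥ 0) : HasDerivAt (fun s => w s - z) (deriv w t) t :=
    (hw₁ t ht).hasDerivAt.sub_const z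
  have hv (t : ℝ) (ht : t ≥ 0) : HasDerivAt (deriv w) (deriv (deriv w) t) t :=
    (hw₂ t ht).hasDerivAt
  have hh (t : ℝ) (ht : t ≥ 0) :
      HasDerivAt (fun s => ‖w s - z‖ ^ 2 / 2) ⟪w t - z, deriv w t⟫ t :=
    ((hu t ht).norm_sq.div_const 2).congr_deriv (by ring)
  have hθ (t : ℝ) (ht : t ≥ 0) :
      HasDerivAt (fun s => κ s / ρ s) (deriv (fun s => κ s / ρ s) t) t :=
    ((hκdiff t ht).div (hρdiff t ht) (hρpos t ht).ne').hasDerivAt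
  have hdiss (t : ℝ) (ht : t ≥ 0) :
      ‖deriv w t‖ ^ 2 + ⟪w t - z, deriv (deriv w) t⟫ + κ t * ⟪w t - z, deriv w t⟫
        + (κ t - 1) * (‖w t - z‖ ^ 2 / 2)
        + a₁ / 2 * (κ t / ρ t * (‖deriv w t‖ ^ 2 + 2 * ⟪deriv w t, deriv (deriv w) t⟫)) ≤ 0 := by
    have hρt := hρpos t ht
    have hAe : ρ t • A (w t) = -(deriv (deriv w) t + κ t • deriv w t) :=
      eq_neg_of_add_eq_zero_right (hode t ht)
    have hin : ρ t * ⟪A (w t), w t - z⟫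
        = -(⟪w t - z, deriv (deriv w) t⟫ + κ t * ⟪w t - z, deriv w t⟫) := by
      rw [← real_inner_smul_left, hAe, real_inner_comm, inner_neg_right, inner_add_right,
        inner_smul_right]
    have hnorm : ρ t ^ 2 * ‖A (w t)‖ ^ 2 = ‖deriv (deriv w) t‖ ^ 2
        + 2 * κ t * ⟪deriv w t, deriv (deriv w) t⟫ + κ t ^ 2 * ‖deriv w t‖ ^ 2 := by
      have : ‖ρ t • A (w t)‖ ^ 2 = ρ t ^ 2 * ‖A (w t)‖ ^ 2 := by
        rw [norm_smul, mul_pow, Real.norm_eq_abs, sq_abs]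
      rw [← this, hAe, norm_neg, norm_add_sq_real, inner_smul_right, norm_smul, mul_pow,
        Real.norm_eq_abs, sq_abs, real_inner_comm]
      ring
    have hcoef : ‖deriv w t‖ ^ 2 ≤ a₁ / 2 / ρ t * ((κ t ^ 2 - κ t) * ‖deriv w t‖ ^ 2) := by
      have h1 : a₁ / 2 / ρ t * (2 * ρ t / a₁) = 1 := by field_simp
      have h2 := mul_le_mul_of_nonneg_left (sub_nonneg.1 (hκρ t ht))
        (show 0 ≤ a₁ / 2 / ρ t by positivity)
      rw [h1] at h2
      calc ‖deriv w t‖ ^ 2 = 1 * ‖deriv w t‖ ^ 2 := (one_mul _).symm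
        _ ≤ a₁ / 2 / ρ t * (κ t ^ 2 - κ t) * ‖deriv w t‖ ^ 2 := by gcongr
        _ = _ := by ring
    have hA1 : (κ t - 1) * (‖w t - z‖ ^ 2 / 2) ≤ ρ t * ⟪A (w t), w t - z⟫ / 2 := by
      have h1 := mul_le_mul_of_nonneg_left (hmono (w t)) hρt.le
      have h2 := mul_le_mul_of_nonneg_right (hκle t ht) (sq_nonneg ‖w t - z‖)
      linarith
    have hA2 : a₁ / 2 / ρ t * (2 * κ t * ⟪deriv w t, deriv (deriv w) t⟫
        + κ t ^ 2 * ‖deriv w t‖ ^ 2) ≤ ρ t * ⟪A (w t), w t - z⟫ / 2 := by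
      have h1 := mul_le_mul_of_nonneg_left (hcoco (w t)) hρt.le
      have h2 : a₁ / 2 / ρ t * (ρ t ^ 2 * ‖A (w t)‖ ^ 2) = ρ t * (a₁ * ‖A (w t)‖ ^ 2) / 2 := by
        field_simp
      have h3 : 0 ≤ a₁ / 2 / ρ t * ‖deriv (deriv w) t‖ ^ 2 := by positivity
      rw [hnorm] at h2
      linarith
    have hsplit : a₁ / 2 * (κ t / ρ t * (‖deriv w t‖ ^ 2 + 2 * ⟪deriv w t, deriv (deriv w) t⟫))
        = a₁ / 2 / ρ t * (2 * κ t * ⟪deriv w t, deriv (deriv w) t⟫ + κ t ^ 2 * ‖deriv w t‖ ^ 2)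
          - a₁ / 2 / ρ t * ((κ t ^ 2 - κ t) * ‖deriv w t‖ ^ 2) := by
      ring
    linarith
  have hlyap (t : ℝ) (ht : t ≥ 0) := le_apply_zero_of_hasDerivAt_nonpos
    (F := fun s => Real.exp s * (⟪w s - z, deriv w s⟫ + (κ s - 1) * (‖w s - z‖ ^ 2 / 2)
      + a₁ / 2 * (κ s / ρ s * ‖deriv w s‖ ^ 2)))
    (fun s hs => (Real.hasDerivAt_exp s).mul
      ((((hu s hs).inner ℝ (hv s hs)).add
        (((hκdiff s hs).hasDerivAt.sub_const 1).mul (hh s hs))).add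
          (((hθ s hs).mul (hv s hs).norm_sq).const_mul (a₁ / 2))))
    (fun s hs => by
      have h1 : deriv κ s * (‖w s - z‖ ^ 2 / 2) ≤ 0 :=
        mul_nonpos_of_nonpos_of_nonneg (hκ' s hs) (by positivity)
      have h2 : a₁ / 2 * (deriv (fun s => κ s / ρ s) s * ‖deriv w s‖ ^ 2) ≤ 0 :=
        mul_nonpos_of_nonneg_of_nonpos (by positivity)
          (mul_nonpos_of_nonpos_of_nonneg (hκρ' s hs) (by positivity))
      rw [← mul_add]
      refine mul_nonpos_of_nonneg_of_nonpos (Real.exp_pos s).le ?_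
      have h3 := hdiss s hs
      rw [real_inner_self_eq_norm_sq]
      simp only [Pi.add_apply, Pi.mul_apply]
      linarith) ht
  obtain ⟨C, hC, c, hc, hbound⟩ := exists_exp_bound_of_deriv_add_mul_le
    (h := fun s => ‖w s - z‖ ^ 2 / 2) (sub_pos.2 hκlow) hh (fun t => by positivity)
    (M := ⟪w 0 - z, deriv w 0⟫ + (κ 0 - 1) * (‖w 0 - z‖ ^ 2 / 2)
      + a₁ / 2 * (κ 0 / ρ 0 * ‖deriv w 0‖ ^ 2))
    (fun t ht => by
      have h1 := hlyap t ht
      simp only [Real.exp_zero, one_mul] at h1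
      have h2 := mul_le_mul_of_nonneg_right h1 (Real.exp_pos (-t)).le
      rw [mul_right_comm, ← Real.exp_add, add_neg_cancel, Real.exp_zero, one_mul] at h2
      have h3 : (κlow - 1) * (‖w t - z‖ ^ 2 / 2) ≤ (κ t - 1) * (‖w t - z‖ ^ 2 / 2) := by
        gcongr
        exact hκge t ht
      have h4 : 0 ≤ a₁ / 2 * (κ t / ρ t * ‖deriv w t‖ ^ 2) := by
        have := hκpos t ht
        have := hρpos t ht
        positivity
      linarith)
  refine ⟨√(2 * C), by positivity, c / 2, by positivity, fun t ht => ?_⟩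
  refine (sq_le_sq₀ (norm_nonneg _) (by positivity)).1 ?_
  rw [mul_pow, Real.sq_sqrt (by positivity), ← Real.exp_nat_mul,
    show ((2 : ℕ) : ℝ) * (-(c / 2) * t) = -c * t by push_cast; ring]
  linarith [hbound t ht]

/-- Exponential convergence of the trajectory of the second-order dynamical
system `w'' + κ(t) w' + ρ(t) A(w) = 0` to the unique solution of the GIMVIP. -/
theorem stmt_10
    {H : Type*} [NormedAddCommGroup H] [InnerProductSpace ℝ H] [CompleteSpace H]
    (K : Set H) (hKne : K.Nonempty) (hKcl : IsClosed K) (hKcv : Convex ℝ K)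
    (f : H → ℝ) (hfcv : ConvexOn ℝ Set.univ f) (hflsc : LowerSemicontinuous f)
    (γ : ℝ) (hγ : 0 < γ)
    (P : H → H)
    (hP : ∀ w : H, P w ∈ K ∧
      ∀ v ∈ K, γ * f (P w) + (1 / 2) * ‖w - P w‖ ^ 2 ≤ γ * f v + (1 / 2) * ‖w - v‖ ^ 2)
    (T g : H → H) (η lam β α : ℝ)
    (hT_lip : ∀ w v : H, ‖T w - T v‖ ≤ η * ‖w - v‖)
    (hT_mono : ∀ w v : H, ⟪T w - T v, w - v⟫ ≥ lam * ‖w - v‖ ^ 2)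
    (hg_lip : ∀ w v : H, ‖g w - g v‖ ≤ β * ‖w - v‖)
    (hcoupled : ∀ w v : H, ⟪T w - T v, g w - g v⟫ ≥ α * ‖w - v‖ ^ 2)
    (A : H → H) (hA : ∀ w : H, A w = T w - P (T w - γ • g w))
    (a : ℝ) (ha_def : a = lam + γ * α - η ^ 2 / 2 - γ ^ 2 * β ^ 2 / 2 - 1 / 2)
    (ha_pos : 0 < a)
    (a₁ : ℝ) (ha₁_def : a₁ = a / (2 * η + γ * β) ^ 2)
    (wstar : H)
    (hsol : T wstar ∈ K ∧ ∀ y ∈ K, ⟪g wstar, y - T wstar⟫ + f y - f (T wstar) ≥ 0)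
    (κ ρ : ℝ → ℝ)
    (hκpos : ∀ t ≥ (0 : ℝ), 0 < κ t) (hρpos : ∀ t ≥ (0 : ℝ), 0 < ρ t)
    (hκdiff : ∀ t ≥ (0 : ℝ), DifferentiableAt ℝ κ t)
    (hρdiff : ∀ t ≥ (0 : ℝ), DifferentiableAt ℝ ρ t)
    (κlow : ℝ) (hκlow : 1 < κlow)
    -- condition (i)
    (hi : ∀ t ≥ (0 : ℝ), κlow ≤ κ t ∧ κ t ≤ a ^ 2 * a₁ * ρ t + 1)
    -- condition (ii)
    (hii₁ : ∀ t ≥ (0 : ℝ), deriv κ t ≤ 0)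
    (hii₂ : ∀ t ≥ (0 : ℝ), deriv (fun s => κ s / ρ s) t ≤ 0)
    -- condition (iii)
    (hiii : ∀ t ≥ (0 : ℝ), κ t ^ 2 - κ t - 2 * ρ t / a₁ ≥ 0)
    (w : ℝ → H)
    (hw₁ : ∀ t ≥ (0 : ℝ), DifferentiableAt ℝ w t)
    (hw₂ : ∀ t ≥ (0 : ℝ), DifferentiableAt ℝ (deriv w) t)
    (hode : ∀ t ≥ (0 : ℝ),
      deriv (deriv w) t + κ t • deriv w t + ρ t • A (w t) = 0) :
    ∃ C > (0 : ℝ), ∃ δ > (0 : ℝ), ∀ t ≥ (0 : ℝ),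
      ‖w t - wstar‖ ≤ C * Real.exp (-δ * t) := by
  rcases subsingleton_or_nontrivial H with hH | hH
  · refine ⟨1, one_pos, 1, one_pos, fun t _ => ?_⟩
    rw [Subsingleton.elim (w t) wstar, sub_self, norm_zero]
    positivity
  have hvar (x v : H) (hv : v ∈ K) : ⟪x - P x, v - P x⟫ ≤ γ * (f v - f (P x)) :=
    inner_le_of_isMin_prox hKcv hfcv hγ.le (hP x).1 (hP x).2 hv
  have hPlip (x y : H) : ‖P x - P y‖ ≤ ‖x - y‖ :=
    norm_sub_le_of_prox_inner_le (hvar x _ (hP y).1)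
      ((hvar y _ (hP x).1).trans_eq (by ring))
  have hA0 : A wstar = 0 := by
    set p := P (T wstar - γ • g wstar) with hp
    have h1 := hvar (T wstar - γ • g wstar) _ hsol.1
    rw [← hp, sub_right_comm, inner_sub_left, real_inner_smul_left,
      real_inner_self_eq_norm_sq] at h1
    have h2 := mul_nonneg hγ.le (hsol.2 p (hP _).1)
    rw [← neg_sub (T wstar) p, inner_neg_right] at h2
    have h3 : ‖T wstar - p‖ ^ 2 ≤ 0 := by linarith
    rw [hA, ← hp]
    exact norm_eq_zero.1 (pow_eq_zero_iff two_ne_zero |>.1 (le_antisymm h3 (sq_nonneg _)))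
  have hsplit (x y : H) : T x - γ • g x - (T y - γ • g y) = (T x - T y) - γ • (g x - g y) := by
    module
  have hAsub (x y : H) : A x - A y
      = (T x - T y) - (P (T x - γ • g x) - P (T y - γ • g y)) := by
    rw [hA, hA]
    abel
  have hAmono (x y : H) : a * ‖x - y‖ ^ 2 ≤ ⟪A x - A y, x - y⟫ := by
    have h1 : ‖P (T x - γ • g x) - P (T y - γ • g y)‖ ^ 2
        ≤ ‖T x - T y‖ ^ 2 - 2 * (γ * ⟪T x - T y, g x - g y⟫) + γ ^ 2 * ‖g x - g y‖ ^ 2 := by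
      refine (pow_le_pow_left₀ (norm_nonneg _) (hPlip _ _) 2).trans_eq ?_
      rw [hsplit, norm_sub_sq_real, inner_smul_right, norm_smul, mul_pow, Real.norm_eq_abs, sq_abs]
    have h2 : ‖T x - T y‖ ^ 2 ≤ η ^ 2 * ‖x - y‖ ^ 2 :=
      (pow_le_pow_left₀ (norm_nonneg _) (hT_lip x y) 2).trans_eq (mul_pow _ _ _)
    have h3 : γ ^ 2 * ‖g x - g y‖ ^ 2 ≤ γ ^ 2 * (β ^ 2 * ‖x - y‖ ^ 2) :=
      mul_le_mul_of_nonneg_left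
        ((pow_le_pow_left₀ (norm_nonneg _) (hg_lip x y) 2).trans_eq (mul_pow _ _ _))
        (sq_nonneg γ)
    have h4 := mul_le_mul_of_nonneg_left (hcoupled x y) hγ.le
    have h5 := norm_sub_sq_real (P (T x - γ • g x) - P (T y - γ • g y)) (x - y)
    have h6 := sq_nonneg ‖P (T x - γ • g x) - P (T y - γ • g y) - (x - y)‖
    have h7 := hT_mono x y
    rw [hAsub, inner_sub_left, ha_def]
    linarith
  have hAlip (x y : H) : ‖A x - A y‖ ≤ (2 * η + γ * β) * ‖x - y‖ := by
    have h1 : ‖T x - γ • g x - (T y - γ • g y)‖ ≤ ‖T x - T y‖ + γ * ‖g x - g y‖ := by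
      rw [hsplit]
      refine (norm_sub_le _ _).trans_eq ?_
      rw [norm_smul, Real.norm_of_nonneg hγ.le]
    have h2 := mul_le_mul_of_nonneg_left (hg_lip x y) hγ.le
    rw [hAsub]
    linarith [norm_sub_le (T x - T y) (P (T x - γ • g x) - P (T y - γ • g y)), hT_lip x y,
      hPlip (T x - γ • g x) (T y - γ • g y)]
  set L := 2 * η + γ * β with hL
  have haL : a ≤ L := by
    obtain ⟨x, hx⟩ := exists_ne (0 : H)
    have h1 := hAmono x 0
    have h2 := real_inner_le_norm (A x - A 0) (x - 0)
    have h3 := mul_le_mul_of_nonneg_right (hAlip x 0) (norm_nonneg (x - 0))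
    rw [sub_zero x] at h1 h2 h3
    have hx' : 0 < ‖x‖ ^ 2 := pow_pos (norm_pos_iff.2 hx) 2
    refine le_of_mul_le_mul_right ?_ hx'
    linarith
  have hLpos : 0 < L := ha_pos.trans_le haL
  have ha₁ : 0 < a₁ := ha₁_def ▸ by positivity
  have ha₁L : a₁ * L ^ 2 = a := by
    rw [ha₁_def]
    field_simp
  have hmono (x : H) : a * ‖x - wstar‖ ^ 2 ≤ ⟪A x, x - wstar⟫ := by
    simpa [hA0] using hAmono x wstar
  have hcoco (x : H) : a₁ * ‖A x‖ ^ 2 ≤ ⟪A x, x - wstar⟫ := by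
    have h1 : ‖A x‖ ≤ L * ‖x - wstar‖ := by simpa [hA0] using hAlip x wstar
    calc a₁ * ‖A x‖ ^ 2 ≤ a₁ * (L * ‖x - wstar‖) ^ 2 := by gcongr
      _ = a * ‖x - wstar‖ ^ 2 := by rw [mul_pow, ← mul_assoc, ha₁L]
      _ ≤ _ := hmono x
  refine exists_exp_bound_of_second_order_ode ha₁ hmono hcoco hκpos hρpos hκdiff hρdiff hκlow
    (fun t ht => (hi t ht).1) (fun t ht => (hi t ht).2.trans ?_) hii₁ hii₂ hiii hw₁ hw₂ hode
  have h1 : a ^ 2 * a₁ ≤ a := by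
    calc a ^ 2 * a₁ ≤ L ^ 2 * a₁ := by gcongr
      _ = a := by rw [mul_comm, ha₁L]
  have := hρpos t ht
  gcongr
end

section
/- Let a > 0, a₁ > 0, 0 < κ < 1 and 0 < ρ < a₁·min{(1 − κ)/4, κ²/(4 − κ)}. Then (a₁/ρ)·(1 − κ) ≥ 4, κ·(a₁κ/ρ + 1) − 4 > 0, and there exists ε > 1 such that: ε·(κ·(a₁κ/ρ + 1) − 4) − (ε − 1)·(a₁κ/ρ + 1) > 0, ε·a·ρ − κ·ε·(ε − 1) + (ε − 1)² > 0, and 1 − ε²·(1 − κ) > 0. -/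
/-- Elementary consequences of the step-size conditions (A1)–(A2) of the
inertial projection algorithm. -/
theorem stmt_13
    (a a₁ κ ρ : ℝ) (ha : 0 < a) (ha₁ : 0 < a₁)
    (hκ₀ : 0 < κ) (hκ₁ : κ < 1)
    (hρ₀ : 0 < ρ) (hρ₁ : ρ < a₁ * min ((1 - κ) / 4) (κ ^ 2 / (4 - κ))) :
    (a₁ / ρ) * (1 - κ) ≥ 4 ∧
    κ * (a₁ * κ / ρ + 1) - 4 > 0 ∧
    ∃ ε > (1 : ℝ),
      ε * (κ * (a₁ * κ / ρ + 1) - 4) - (ε - 1) * (a₁ * κ / ρ + 1) > 0 ∧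
      ε * a * ρ - κ * ε * (ε - 1) + (ε - 1) ^ 2 > 0 ∧
      1 - ε ^ 2 * (1 - κ) > 0 := by
  have h₁ : ρ < a₁ * ((1 - κ) / 4) :=
    hρ₁.trans_le (mul_le_mul_of_nonneg_left (min_le_left _ _) ha₁.le)
  have h₂ : ρ < a₁ * (κ ^ 2 / (4 - κ)) :=
    hρ₁.trans_le (mul_le_mul_of_nonneg_left (min_le_right _ _) ha₁.le)
  have hfirst : (a₁ / ρ) * (1 - κ) ≥ 4 := by
    rw [ge_iff_le, div_mul_eq_mul_div, le_div_iff₀ hρ₀]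
    linarith
  have hsecond : κ * (a₁ * κ / ρ + 1) - 4 > 0 := by
    rw [← mul_div_assoc, lt_div_iff₀ (by linarith)] at h₂
    have h : 4 - κ < a₁ * κ ^ 2 / ρ := by
      rw [lt_div_iff₀ hρ₀]
      linarith
    have heq : κ * (a₁ * κ / ρ + 1) = a₁ * κ ^ 2 / ρ + κ := by ring
    linarith
  refine ⟨hfirst, hsecond, ?_⟩
  generalize a₁ * κ / ρ + 1 = c at hsecond ⊢
  have eventually_pos {f : ℝ → ℝ} (hf : Continuous f) (h : 0 < f 1) :
      ∀ᶠ ε in nhdsWithin 1 (Set.Ioi 1), 0 < f ε :=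
    (hf.continuousAt.eventually (lt_mem_nhds h)).filter_mono nhdsWithin_le_nhds
  have e₁ := eventually_pos (f := fun ε ↦ ε * (κ * c - 4) - (ε - 1) * c)
    (by fun_prop) (by simpa using hsecond)
  have e₂ := eventually_pos (f := fun ε ↦ ε * a * ρ - κ * ε * (ε - 1) + (ε - 1) ^ 2)
    (by fun_prop) (by simpa using mul_pos ha hρ₀)
  have e₃ := eventually_pos (f := fun ε ↦ 1 - ε ^ 2 * (1 - κ))
    (by fun_prop) (by simpa using hκ₀)
  obtain ⟨ε, hε, h⟩ :=
    (eventually_mem_nhdsWithin.and (e₁.and (e₂.and e₃))).exists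
  exact ⟨ε, hε, h⟩
end

section
/- Suppose a := λ + γα − η²/2 − γ²β²/2 − 1/2 > 0, set a₁ := a/(2η + γβ)², let w* be a solution of the GIMVIP, and assume 0 < κ < 1 and 0 < ρ < a₁·min{(1 − κ)/4, κ²/(4 − κ)}. Let (wₙ) be a sequence in H satisfying the inertial projection recursion w_{n+1} = wₙ + (1 − κ)(wₙ − w_{n−1}) − ρ·A(wₙ) for all n ≥ 1. Define xₙ := ‖wₙ − w*‖², yₙ := ‖wₙ − w_{n−1}‖², C₀ := κ·(a₁κ/ρ + 1) − 4 and C₁ := a₁κ/ρ + 1. Then for all n ≥ 1: (x_{n+1} − 2xₙ + x_{n−1}) + κ·(xₙ − x_{n−1}) + a·ρ·xₙ + C₀·yₙ + C₁·(y_{n+1} − yₙ) ≤ 0. -/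
open scoped RealInnerProductSpace

section GeneralizedProjection

variable {H : Type*} [NormedAddCommGroup H] [InnerProductSpace ℝ H]

/-- A minimizer `p` of `γ f + ½‖w - ·‖²` over a convex set satisfies the associated
variational inequality. -/
theorem inner_le_of_forall_le_prox {K : Set H} (hK : Convex ℝ K) {f : H → ℝ}
    (hf : ConvexOn ℝ Set.univ f) {γ : ℝ} (hγ : 0 < γ) {w p : H} (hp : p ∈ K)
    (hmin : ∀ v ∈ K, γ * f p + (1 / 2) * ‖w - p‖ ^ 2 ≤ γ * f v + (1 / 2) * ‖w - v‖ ^ 2)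
    {v : H} (hv : v ∈ K) : ⟪w - p, v - p⟫ ≤ γ * f v - γ * f p := by
  have key : ∀ t : ℝ, 0 < t → t ≤ 1 →
      ⟪w - p, v - p⟫ ≤ γ * f v - γ * f p + t * (‖v - p‖ ^ 2 / 2) := by
    intro t ht ht1
    have hmem : (1 - t) • p + t • v ∈ K := hK hp hv (by linarith) ht.le (by ring)
    have hconv : f ((1 - t) • p + t • v) ≤ (1 - t) * f p + t * f v :=
      hf.2 (Set.mem_univ p) (Set.mem_univ v) (by linarith) ht.le (by ring)
    have hle := hmin _ hmem
    have hsub : w - ((1 - t) • p + t • v) = (w - p) - t • (v - p) := by module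
    rw [hsub, norm_sub_sq_real (w - p), inner_smul_right, norm_smul, mul_pow, Real.norm_eq_abs,
      sq_abs] at hle
    have hγf := mul_le_mul_of_nonneg_left hconv hγ.le
    refine le_of_mul_le_mul_left ?_ ht
    nlinarith
  refine le_of_forall_pos_le_add fun ε hε => ?_
  have hpos : 0 < ‖v - p‖ ^ 2 / 2 + 1 := by positivity
  have ht : 0 < min 1 (ε / (‖v - p‖ ^ 2 / 2 + 1)) := lt_min one_pos (div_pos hε hpos)
  have h := key _ ht (min_le_left _ _)
  have h' := (le_div_iff₀ hpos).1 (min_le_right 1 (ε / (‖v - p‖ ^ 2 / 2 + 1)))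
  linarith

/-- Solutions of the generalized projection inequality depend nonexpansively on the data. -/
theorem norm_sub_le_of_inner_le {φ : H → ℝ} {w₁ w₂ p q : H}
    (hp : ⟪w₁ - p, q - p⟫ ≤ φ q - φ p) (hq : ⟪w₂ - q, p - q⟫ ≤ φ p - φ q) :
    ‖p - q‖ ≤ ‖w₁ - w₂‖ := by
  have hid : ⟪w₁ - p, q - p⟫ + ⟪w₂ - q, p - q⟫ = ‖p - q‖ ^ 2 - ⟪w₁ - w₂, p - q⟫ := by
    rw [← real_inner_self_eq_norm_sq, ← neg_sub p q, inner_neg_right, ← sub_eq_neg_add,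
      ← inner_sub_left, ← inner_sub_left]
    congr 1
    abel
  have hcs := real_inner_le_norm (w₁ - w₂) (p - q)
  by_contra! hlt
  nlinarith [norm_nonneg (w₁ - w₂)]

/-- Strong monotonicity of `t - r` against `u`, when `r` is dominated by `t - γ s`. -/
theorem le_inner_sub_of_norm_le {t s r u : H} {γ η lam β α : ℝ} (hγ : 0 ≤ γ)
    (ht : ‖t‖ ≤ η * ‖u‖) (htu : lam * ‖u‖ ^ 2 ≤ ⟪t, u⟫) (hs : ‖s‖ ≤ β * ‖u‖)
    (hts : α * ‖u‖ ^ 2 ≤ ⟪t, s⟫) (hr : ‖r‖ ≤ ‖t - γ • s‖) :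
    (lam + γ * α - η ^ 2 / 2 - γ ^ 2 * β ^ 2 / 2 - 1 / 2) * ‖u‖ ^ 2 ≤ ⟪t - r, u⟫ := by
  have hr2 : ‖r‖ ^ 2 ≤ ‖t‖ ^ 2 - 2 * (γ * ⟪t, s⟫) + γ ^ 2 * ‖s‖ ^ 2 := by
    have h := pow_le_pow_left₀ (norm_nonneg r) hr 2
    rwa [norm_sub_sq_real, inner_smul_right, norm_smul, mul_pow, Real.norm_eq_abs, sq_abs] at h
  have ht2 := pow_le_pow_left₀ (norm_nonneg t) ht 2
  have hs2 := mul_le_mul_of_nonneg_left (pow_le_pow_left₀ (norm_nonneg s) hs 2) (sq_nonneg γ)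
  have hts' := mul_le_mul_of_nonneg_left hts hγ
  have hru : 0 ≤ ‖r‖ ^ 2 - 2 * ⟪r, u⟫ + ‖u‖ ^ 2 := by
    rw [← norm_sub_sq_real]; positivity
  rw [inner_sub_left]
  nlinarith

/-- Growth bound for `t - r`, when `r` is dominated by `t - γ s`. -/
theorem norm_sub_le_of_norm_le {t s r u : H} {γ η β : ℝ} (hγ : 0 ≤ γ)
    (ht : ‖t‖ ≤ η * ‖u‖) (hs : ‖s‖ ≤ β * ‖u‖) (hr : ‖r‖ ≤ ‖t - γ • s‖) :
    ‖t - r‖ ≤ (2 * η + γ * β) * ‖u‖ := by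
  have h1 := norm_sub_le t r
  have h2 := norm_sub_le t (γ • s)
  rw [norm_smul, Real.norm_of_nonneg hγ] at h2
  have h3 := mul_le_mul_of_nonneg_left hs hγ
  linarith

/-- One step of the inertial recursion, with `u = wₙ - w*`, `d = wₙ - wₙ₋₁`, `A = A wₙ` and
`e = wₙ₊₁ - wₙ`. -/
theorem inertial_step_le {u d e A : H} {a a₁ κ ρ : ℝ} (hρ : 0 < ρ) (hρa : 4 * ρ ≤ a₁ * (1 - κ))
    (hmono : a * ‖u‖ ^ 2 ≤ ⟪A, u⟫) (hlip : a₁ * ‖A‖ ^ 2 ≤ a * ‖u‖ ^ 2)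
    (he : e = (1 - κ) • d - ρ • A) :
    (‖u + e‖ ^ 2 - 2 * ‖u‖ ^ 2 + ‖u - d‖ ^ 2) + κ * (‖u‖ ^ 2 - ‖u - d‖ ^ 2) + a * ρ * ‖u‖ ^ 2 +
      (κ * (a₁ * κ / ρ + 1) - 4) * ‖d‖ ^ 2 +
      (a₁ * κ / ρ + 1) * (‖e‖ ^ 2 - ‖d‖ ^ 2) ≤ 0 := by
  have heu : ⟪u, e⟫ = (1 - κ) * ⟪u, d⟫ - ρ * ⟪A, u⟫ := by
    rw [he, inner_sub_right, inner_smul_right, inner_smul_right, real_inner_comm u A]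
  have hA : ρ ^ 2 * ‖A‖ ^ 2 =
      ‖e‖ ^ 2 - 2 * ((1 - κ) * ⟪e, d⟫) + (1 - κ) ^ 2 * ‖d‖ ^ 2 := by
    have h : -(ρ • A) = e - (1 - κ) • d := by rw [he]; abel
    have h' := congrArg (fun z => ‖z‖ ^ 2) h
    simpa only [norm_neg, norm_sub_sq_real, inner_smul_right, norm_smul, mul_pow,
      Real.norm_eq_abs, sq_abs] using h'
  have hz : 0 ≤ ‖e‖ ^ 2 - 2 * ⟪e, d⟫ + ‖d‖ ^ 2 := by
    rw [← norm_sub_sq_real]; positivity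
  have hpar : 0 ≤ ‖e‖ ^ 2 - 2 * (2 * ⟪e, d⟫) + 2 ^ 2 * ‖d‖ ^ 2 := by
    have h := sq_nonneg ‖e - (2 : ℝ) • d‖
    simpa only [norm_sub_sq_real, inner_smul_right, norm_smul, mul_pow,
      Real.norm_eq_abs, sq_abs] using h
  obtain ⟨c, rfl⟩ : ∃ c, a₁ = c * ρ := ⟨a₁ / ρ, by field_simp⟩
  have hc : 4 ≤ c * (1 - κ) := le_of_mul_le_mul_right (by linarith) hρ
  have hcκ : c * ρ * κ / ρ = c * κ := by field_simp
  rw [hcκ, norm_add_sq_real, norm_sub_sq_real, heu]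
  have hm := mul_le_mul_of_nonneg_left hmono hρ.le
  have hl := mul_le_mul_of_nonneg_left hlip hρ.le
  have hl' : c * (‖e‖ ^ 2 - 2 * ((1 - κ) * ⟪e, d⟫) + (1 - κ) ^ 2 * ‖d‖ ^ 2) ≤
      ρ * (a * ‖u‖ ^ 2) := by
    rw [← hA]; linarith
  have hcz := mul_le_mul_of_nonneg_right hc hz
  linarith

end GeneralizedProjection

/-- Key discrete energy inequality for the inertial projection algorithm. -/
theorem stmt_14
    {H : Type*} [NormedAddCommGroup H] [InnerProductSpace ℝ H] [CompleteSpace H]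
    (K : Set H) (hKne : K.Nonempty) (hKcl : IsClosed K) (hKcv : Convex ℝ K)
    (f : H → ℝ) (hfcv : ConvexOn ℝ Set.univ f) (hflsc : LowerSemicontinuous f)
    (γ : ℝ) (hγ : 0 < γ)
    (P : H → H)
    (hP : ∀ w : H, P w ∈ K ∧
      ∀ v ∈ K, γ * f (P w) + (1 / 2) * ‖w - P w‖ ^ 2 ≤ γ * f v + (1 / 2) * ‖w - v‖ ^ 2)
    (T g : H → H) (η lam β α : ℝ)
    (hT_lip : ∀ w v : H, ‖T w - T v‖ ≤ η * ‖w - v‖)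
    (hT_mono : ∀ w v : H, ⟪T w - T v, w - v⟫ ≥ lam * ‖w - v‖ ^ 2)
    (hg_lip : ∀ w v : H, ‖g w - g v‖ ≤ β * ‖w - v‖)
    (hcoupled : ∀ w v : H, ⟪T w - T v, g w - g v⟫ ≥ α * ‖w - v‖ ^ 2)
    (A : H → H) (hA : ∀ w : H, A w = T w - P (T w - γ • g w))
    (a : ℝ) (ha_def : a = lam + γ * α - η ^ 2 / 2 - γ ^ 2 * β ^ 2 / 2 - 1 / 2)
    (ha_pos : 0 < a)
    (a₁ : ℝ) (ha₁_def : a₁ = a / (2 * η + γ * β) ^ 2)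
    (wstar : H)
    (hsol : T wstar ∈ K ∧ ∀ y ∈ K, ⟪g wstar, y - T wstar⟫ + f y - f (T wstar) ≥ 0)
    (κ ρ : ℝ) (hκ₀ : 0 < κ) (hκ₁ : κ < 1)
    (hρ₀ : 0 < ρ) (hρ₁ : ρ < a₁ * min ((1 - κ) / 4) (κ ^ 2 / (4 - κ)))
    (w : ℕ → H)
    (hrec : ∀ n : ℕ, 1 ≤ n →
      w (n + 1) = w n + (1 - κ) • (w n - w (n - 1)) - ρ • A (w n))
    (x y : ℕ → ℝ)
    (hx : ∀ n : ℕ, x n = ‖w n - wstar‖ ^ 2)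
    (hy : ∀ n : ℕ, y n = ‖w n - w (n - 1)‖ ^ 2)
    (C₀ C₁ : ℝ)
    (hC₀ : C₀ = κ * (a₁ * κ / ρ + 1) - 4)
    (hC₁ : C₁ = a₁ * κ / ρ + 1) :
    ∀ n : ℕ, 1 ≤ n →
      (x (n + 1) - 2 * x n + x (n - 1)) + κ * (x n - x (n - 1)) + a * ρ * x n +
        C₀ * y n + C₁ * (y (n + 1) - y n) ≤ 0 := by
  intro n hn
  have hfix : ∀ v ∈ K, ⟪(T wstar - γ • g wstar) - T wstar, v - T wstar⟫ ≤
      γ * f v - γ * f (T wstar) := by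
    intro v hv
    have h := mul_nonneg hγ.le (hsol.2 v hv)
    rw [sub_sub_cancel_left, inner_neg_left, real_inner_smul_left]
    linarith
  obtain ⟨hPK, hPmin⟩ := hP (T (w n) - γ • g (w n))
  have hr : ‖P (T (w n) - γ • g (w n)) - T wstar‖ ≤
      ‖(T (w n) - T wstar) - γ • (g (w n) - g wstar)‖ := by
    have h := norm_sub_le_of_inner_le (φ := fun v => γ * f v)
      (inner_le_of_forall_le_prox hKcv hfcv hγ hPK hPmin hsol.1) (hfix _ hPK)
    convert h using 2
    module
  have hAeq : A (w n) = (T (w n) - T wstar) - (P (T (w n) - γ • g (w n)) - T wstar) := by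
    rw [hA, sub_sub_sub_cancel_right]
  have hmono : a * ‖w n - wstar‖ ^ 2 ≤ ⟪A (w n), w n - wstar⟫ := by
    rw [hAeq, ha_def]
    exact le_inner_sub_of_norm_le hγ.le (hT_lip _ _) (hT_mono _ _) (hg_lip _ _) (hcoupled _ _) hr
  have ha₁ : 0 ≤ a₁ := by rw [ha₁_def]; positivity
  have hlip : a₁ * ‖A (w n)‖ ^ 2 ≤ a * ‖w n - wstar‖ ^ 2 := by
    have h : ‖A (w n)‖ ≤ (2 * η + γ * β) * ‖w n - wstar‖ := by
      rw [hAeq]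
      exact norm_sub_le_of_norm_le hγ.le (hT_lip _ _) (hg_lip _ _) hr
    have h2 := mul_le_mul_of_nonneg_left (pow_le_pow_left₀ (norm_nonneg _) h 2) ha₁
    refine h2.trans ?_
    have hL : a₁ * (2 * η + γ * β) ^ 2 ≤ a := by
      rw [ha₁_def, div_mul_comm]
      exact mul_le_of_le_one_left ha_pos.le (div_self_le_one _)
    rw [mul_pow, ← mul_assoc]
    exact mul_le_mul_of_nonneg_right hL (sq_nonneg _)
  have hρa : 4 * ρ ≤ a₁ * (1 - κ) := by
    have h := mul_le_mul_of_nonneg_left (min_le_left ((1 - κ) / 4) (κ ^ 2 / (4 - κ))) ha₁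
    linarith
  have he : w (n + 1) - w n = (1 - κ) • (w n - w (n - 1)) - ρ • A (w n) := by
    rw [hrec n hn]; abel
  have h := inertial_step_le hρ₀ hρa hmono hlip he
  rw [hC₀, hC₁, hx, hx, hx, hy, hy, Nat.add_sub_cancel]
  rwa [sub_sub_sub_cancel_left, add_comm (w n - wstar),
    sub_add_sub_cancel] at h
end

section
/- Suppose a := λ + γα − η²/2 − γ²β²/2 − 1/2 > 0, set a₁ := a/(2η + γβ)², let w* be a solution of the GIMVIP, and assume (A1) 0 < κ < 1 and (A2) 0 < ρ < a₁·min{(1 − κ)/4, κ²/(4 − κ)}. Let (wₙ) be a sequence in H satisfying w_{n+1} = wₙ + (1 − κ)(wₙ − w_{n−1}) − ρ·A(wₙ) for all n ≥ 1. Then (wₙ) converges linearly to w*: there exist constants ε > 1 and M ≥ 0 such that ‖w_{k+1} − w*‖² ≤ (M·k + ε·‖w₁ − w*‖²)·ε^{−(k+1)} for all k ≥ 1. -/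
open scoped RealInnerProductSpace

section GeneralizedProjection

variable {H : Type*} [NormedAddCommGroup H] [InnerProductSpace ℝ H]

/-- A minimiser of `φ + ½‖z - ·‖²` over a convex set satisfies the associated variational
inequality. -/
lemma inner_sub_le_of_isMinOn_prox {K : Set H} {φ : H → ℝ} (hφ : ConvexOn ℝ K φ) {z p v : H}
    (hp : p ∈ K) (hv : v ∈ K)
    (hmin : ∀ x ∈ K, φ p + (1 / 2) * ‖z - p‖ ^ 2 ≤ φ x + (1 / 2) * ‖z - x‖ ^ 2) :
    ⟪z - p, v - p⟫ ≤ φ v - φ p := by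
  have key : ∀ t : ℝ, 0 < t → t ≤ 1 →
      ⟪z - p, v - p⟫ - (φ v - φ p) ≤ t * ‖v - p‖ ^ 2 := by
    intro t ht ht1
    have hx := hmin _ (hφ.1 hp hv (sub_nonneg.2 ht1) ht.le (by ring))
    have hc := hφ.2 hp hv (sub_nonneg.2 ht1) ht.le (by ring)
    have hz : z - ((1 - t) • p + t • v) = (z - p) - t • (v - p) := by module
    rw [hz, norm_sub_sq_real (z - p), real_inner_smul_right, norm_smul, mul_pow,
      Real.norm_eq_abs, sq_abs] at hx
    simp only [smul_eq_mul] at hc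
    have hN : 0 ≤ t * (t * ‖v - p‖ ^ 2) := by positivity
    refine le_of_mul_le_mul_left ?_ ht
    nlinarith
  by_contra! hlt
  set X := ⟪z - p, v - p⟫ - (φ v - φ p) with hX
  have hX0 : 0 < X := by linarith
  have hN : 0 ≤ ‖v - p‖ ^ 2 := by positivity
  have hd : 0 < X + ‖v - p‖ ^ 2 := by linarith
  have h := key (X / (X + ‖v - p‖ ^ 2)) (by positivity) ((div_le_one hd).2 (by linarith))
  rw [div_mul_eq_mul_div, le_div_iff₀ hd] at h
  nlinarith

/-- Points satisfying the proximal variational inequality depend on the base point in a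
nonexpansive way. -/
lemma norm_sub_le_of_prox_variational {φ : H → ℝ} {z z' p q : H}
    (hp : ⟪z - p, q - p⟫ ≤ φ q - φ p) (hq : ⟪z' - q, p - q⟫ ≤ φ p - φ q) :
    ‖p - q‖ ≤ ‖z - z'‖ := by
  have h1 : ‖p - q‖ ^ 2 ≤ ⟪z - z', p - q⟫ := by
    have e : ⟪z - z', p - q⟫ = ‖p - q‖ ^ 2 - ⟪z - p, q - p⟫ - ⟪z' - q, p - q⟫ := by
      rw [← real_inner_self_eq_norm_sq, ← neg_sub p q, inner_neg_right, sub_neg_eq_add,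
        ← inner_add_left, ← inner_sub_left]
      congr 1
      abel
    linarith
  have h2 := real_inner_le_norm (z - z') (p - q)
  rcases (norm_nonneg (p - q)).eq_or_lt with h0 | h0
  · rw [← h0]
    positivity
  · refine le_of_mul_le_mul_right ?_ h0
    nlinarith

/-- One step of the inertial iteration contracts the energy `‖κu + θd‖² + θ‖d‖²` (with
`θ = 1 - κ`), up to a negative definite quadratic form in `(u, d)`. -/
lemma inertial_energy_step {u d y : H} {a a₁ κ ρ : ℝ} (hκ₀ : 0 < κ) (hκ₁ : κ < 1)
    (hρ₀ : 0 < ρ) (hρ₁ : ρ * (4 - κ) ≤ a₁ * κ ^ 2)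
    (hmono : a * ‖u‖ ^ 2 ≤ ⟪y, u⟫) (hcoco : a₁ * ‖y‖ ^ 2 ≤ ⟪y, u⟫) :
    ‖κ • (u + ((1 - κ) • d - ρ • y)) + (1 - κ) • ((1 - κ) • d - ρ • y)‖ ^ 2
        + (1 - κ) * ‖(1 - κ) • d - ρ • y‖ ^ 2 ≤
      ‖κ • u + (1 - κ) • d‖ ^ 2 + (1 - κ) * ‖d‖ ^ 2
        - ρ * κ * a * ‖u‖ ^ 2 - (1 - κ) * κ * (2 - κ) / 2 * ‖d‖ ^ 2 := by
  have e1 : κ • (u + ((1 - κ) • d - ρ • y)) + (1 - κ) • ((1 - κ) • d - ρ • y)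
      = (κ • u + (1 - κ) • d) - ρ • y := by module
  have e2 : ⟪κ • u + (1 - κ) • d, y⟫ = κ * ⟪y, u⟫ + (1 - κ) * ⟪y, d⟫ := by
    rw [inner_add_left, real_inner_smul_left, real_inner_smul_left, real_inner_comm u y,
      real_inner_comm d y]
  have e3 : ‖(1 - κ) • d - ρ • y‖ ^ 2
      = (1 - κ) ^ 2 * ‖d‖ ^ 2 - 2 * (1 - κ) * ρ * ⟪y, d⟫ + ρ ^ 2 * ‖y‖ ^ 2 := by
    rw [norm_sub_sq_real, norm_smul, norm_smul, mul_pow, mul_pow, Real.norm_eq_abs,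
      Real.norm_eq_abs, sq_abs, sq_abs, real_inner_smul_left, real_inner_smul_right,
      real_inner_comm d y]
    ring
  have e4 : 0 ≤ κ ^ 2 * ‖d‖ ^ 2 + 4 * κ * ρ * ⟪y, d⟫ + 4 * ρ ^ 2 * ‖y‖ ^ 2 := by
    have h : ‖κ • d + (2 * ρ) • y‖ ^ 2
        = κ ^ 2 * ‖d‖ ^ 2 + 4 * κ * ρ * ⟪y, d⟫ + 4 * ρ ^ 2 * ‖y‖ ^ 2 := by
      rw [norm_add_sq_real, norm_smul, norm_smul, mul_pow, mul_pow, Real.norm_eq_abs,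
        Real.norm_eq_abs, sq_abs, sq_abs, real_inner_smul_left, real_inner_smul_right,
        real_inner_comm d y]
      ring
    rw [← h]
    positivity
  rw [e1, norm_sub_sq_real, real_inner_smul_right, e2, e3, norm_smul, mul_pow, Real.norm_eq_abs,
    sq_abs]
  have hθ : 0 < 1 - κ := by linarith
  have m1 := mul_le_mul_of_nonneg_left hmono (mul_pos hρ₀ hκ₀).le
  have m2 := mul_le_mul_of_nonneg_left hcoco (mul_pos hρ₀ (pow_pos hκ₀ 2)).le
  have m3 := mul_le_mul_of_nonneg_right hρ₁ (mul_nonneg hρ₀.le (sq_nonneg ‖y‖))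
  have m4 := mul_nonneg (mul_pos hθ (show 0 < 2 - κ by linarith)).le e4
  have m5 : 0 ≤ (ρ ^ 2 * ‖y‖ ^ 2) * (κ * (3 - κ)) :=
    mul_nonneg (by positivity) (mul_nonneg hκ₀.le (by linarith))
  refine le_of_mul_le_mul_left ?_ hκ₀
  nlinarith [mul_le_mul_of_nonneg_left m1 hκ₀.le]

/-- Linear convergence to `0` of the inertial iteration driven by `y` when `y n` is strongly
monotone and cocoercive relative to `u n`. -/
lemma inertial_linear_convergence {u y : ℕ → H} {a a₁ κ ρ : ℝ} (ha : 0 < a) (hκ₀ : 0 < κ)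
    (hκ₁ : κ < 1) (hρ₀ : 0 < ρ) (hρ₁ : ρ * (4 - κ) ≤ a₁ * κ ^ 2)
    (hmono : ∀ n, a * ‖u n‖ ^ 2 ≤ ⟪y n, u n⟫) (hcoco : ∀ n, a₁ * ‖y n‖ ^ 2 ≤ ⟪y n, u n⟫)
    (hrec : ∀ n, u (n + 2) = u (n + 1) + ((1 - κ) • (u (n + 1) - u n) - ρ • y (n + 1))) :
    ∃ q : ℝ, 0 < q ∧ q < 1 ∧ ∃ C : ℝ, 0 ≤ C ∧ ∀ n, ‖u (n + 1)‖ ^ 2 ≤ C * q ^ n := by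
  have hθ : 0 < 1 - κ := by linarith
  set E : ℕ → ℝ := fun n => ‖κ • u (n + 1) + (1 - κ) • (u (n + 1) - u n)‖ ^ 2
    + (1 - κ) * ‖u (n + 1) - u n‖ ^ 2 with hE
  set c := (1 - κ) * κ * (2 - κ) / 2 with hc
  have hc0 : 0 < c := by
    have : 0 < 2 - κ := by linarith
    positivity
  have hc1 : c < 1 := by nlinarith [sq_nonneg (2 * κ - 1), mul_pos hθ hκ₀]
  set δ := min (ρ * κ * a) c / 3 with hδ
  have hδ0 : 0 < δ := by positivity
  have hδ1 : 3 * δ ≤ ρ * κ * a := by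
    have := min_le_left (ρ * κ * a) c
    linarith
  have hδ2 : 3 * δ ≤ c := by
    have := min_le_right (ρ * κ * a) c
    linarith
  have hstep : ∀ n, E (n + 1) ≤ (1 - δ) * E n := by
    intro n
    have h := inertial_energy_step (d := u (n + 1) - u n) hκ₀ hκ₁ hρ₀ hρ₁ (hmono (n + 1))
      (hcoco (n + 1))
    have hd : u (n + 2) - u (n + 1) = (1 - κ) • (u (n + 1) - u n) - ρ • y (n + 1) := by
      rw [hrec n]
      abel
    rw [← hrec n, ← hd] at h
    have hb : E n ≤ 3 * (‖u (n + 1)‖ ^ 2 + ‖u (n + 1) - u n‖ ^ 2) := by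
      have h1 := parallelogram_law_with_norm ℝ (κ • u (n + 1)) ((1 - κ) • (u (n + 1) - u n))
      rw [norm_smul, norm_smul, Real.norm_eq_abs, Real.norm_eq_abs, abs_of_pos hκ₀,
        abs_of_pos hθ] at h1
      have h2 : κ ^ 2 * ‖u (n + 1)‖ ^ 2 ≤ 1 * ‖u (n + 1)‖ ^ 2 := by
        gcongr
        nlinarith
      have h3 : (1 - κ) ^ 2 * ‖u (n + 1) - u n‖ ^ 2 ≤ 1 * ‖u (n + 1) - u n‖ ^ 2 := by
        gcongr
        nlinarith
      have h4 : (1 - κ) * ‖u (n + 1) - u n‖ ^ 2 ≤ 1 * ‖u (n + 1) - u n‖ ^ 2 := by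
        gcongr
        linarith
      simp only [hE]
      nlinarith [norm_nonneg (κ • u (n + 1) - (1 - κ) • (u (n + 1) - u n)),
        sq_nonneg ‖u (n + 1)‖]
    have h5 := mul_le_mul_of_nonneg_right hδ1 (sq_nonneg ‖u (n + 1)‖)
    have h6 := mul_le_mul_of_nonneg_right hδ2 (sq_nonneg ‖u (n + 1) - u n‖)
    have h7 := mul_le_mul_of_nonneg_left hb hδ0.le
    have h8 : E (n + 1) ≤ E n - ρ * κ * a * ‖u (n + 1)‖ ^ 2
        - c * ‖u (n + 1) - u n‖ ^ 2 := h
    linarith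
  have hdecay : ∀ n, E n ≤ E 0 * (1 - δ) ^ n := by
    intro n
    induction n with
    | zero => simp
    | succ n ih =>
      calc E (n + 1) ≤ (1 - δ) * E n := hstep n
        _ ≤ (1 - δ) * (E 0 * (1 - δ) ^ n) := by
          gcongr
          linarith
        _ = E 0 * (1 - δ) ^ (n + 1) := by ring
  have hbound : ∀ n, ‖u (n + 1)‖ ^ 2 ≤ 2 / κ ^ 2 * E n := by
    intro n
    have h1 := parallelogram_law_with_norm ℝ (κ • u (n + 1) + (1 - κ) • (u (n + 1) - u n))
      ((1 - κ) • (u (n + 1) - u n))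
    rw [add_sub_cancel_right, norm_smul κ, norm_smul (1 - κ), Real.norm_eq_abs,
      Real.norm_eq_abs, abs_of_pos hκ₀, abs_of_pos hθ] at h1
    have h2 : (1 - κ) ^ 2 * ‖u (n + 1) - u n‖ ^ 2 ≤ (1 - κ) * ‖u (n + 1) - u n‖ ^ 2 := by
      gcongr
      nlinarith
    rw [div_mul_eq_mul_div, le_div_iff₀ (by positivity)]
    simp only [hE]
    nlinarith [mul_self_nonneg ‖κ • u (n + 1) + (1 - κ) • (u (n + 1) - u n)
      + (1 - κ) • (u (n + 1) - u n)‖]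
  have hE0 : 0 ≤ E 0 := by positivity
  refine ⟨1 - δ, by linarith, by linarith, 2 / κ ^ 2 * E 0, by positivity, fun n => ?_⟩
  calc ‖u (n + 1)‖ ^ 2 ≤ 2 / κ ^ 2 * E n := hbound n
    _ ≤ 2 / κ ^ 2 * (E 0 * (1 - δ) ^ n) := by
      gcongr
      exact hdecay n
    _ = 2 / κ ^ 2 * E 0 * (1 - δ) ^ n := by ring

end GeneralizedProjection

/-- Linear convergence of the inertial projection algorithm to the unique
solution of the GIMVIP. -/
theorem stmt_15
    {H : Type*} [NormedAddCommGroup H] [InnerProductSpace ℝ H] [CompleteSpace H]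
    (K : Set H) (hKne : K.Nonempty) (hKcl : IsClosed K) (hKcv : Convex ℝ K)
    (f : H → ℝ) (hfcv : ConvexOn ℝ Set.univ f) (hflsc : LowerSemicontinuous f)
    (γ : ℝ) (hγ : 0 < γ)
    (P : H → H)
    (hP : ∀ w : H, P w ∈ K ∧
      ∀ v ∈ K, γ * f (P w) + (1 / 2) * ‖w - P w‖ ^ 2 ≤ γ * f v + (1 / 2) * ‖w - v‖ ^ 2)
    (T g : H → H) (η lam β α : ℝ)
    (hT_lip : ∀ w v : H, ‖T w - T v‖ ≤ η * ‖w - v‖)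
    (hT_mono : ∀ w v : H, ⟪T w - T v, w - v⟫ ≥ lam * ‖w - v‖ ^ 2)
    (hg_lip : ∀ w v : H, ‖g w - g v‖ ≤ β * ‖w - v‖)
    (hcoupled : ∀ w v : H, ⟪T w - T v, g w - g v⟫ ≥ α * ‖w - v‖ ^ 2)
    (A : H → H) (hA : ∀ w : H, A w = T w - P (T w - γ • g w))
    (a : ℝ) (ha_def : a = lam + γ * α - η ^ 2 / 2 - γ ^ 2 * β ^ 2 / 2 - 1 / 2)
    (ha_pos : 0 < a)
    (a₁ : ℝ) (ha₁_def : a₁ = a / (2 * η + γ * β) ^ 2)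
    (wstar : H)
    (hsol : T wstar ∈ K ∧ ∀ y ∈ K, ⟪g wstar, y - T wstar⟫ + f y - f (T wstar) ≥ 0)
    (κ ρ : ℝ) (hκ₀ : 0 < κ) (hκ₁ : κ < 1)
    (hρ₀ : 0 < ρ) (hρ₁ : ρ < a₁ * min ((1 - κ) / 4) (κ ^ 2 / (4 - κ)))
    (w : ℕ → H)
    (hrec : ∀ n : ℕ, 1 ≤ n →
      w (n + 1) = w n + (1 - κ) • (w n - w (n - 1)) - ρ • A (w n)) :
    ∃ ε > (1 : ℝ), ∃ M ≥ (0 : ℝ), ∀ k : ℕ, 1 ≤ k →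
      ‖w (k + 1) - wstar‖ ^ 2 ≤
        (M * k + ε * ‖w 1 - wstar‖ ^ 2) / ε ^ (k + 1) := by
  have hproj : ∀ x, ‖P (T x - γ • g x) - T wstar‖
      ≤ ‖(T x - γ • g x) - (T wstar - γ • g wstar)‖ := by
    intro x
    obtain ⟨hPK, hmin⟩ := hP (T x - γ • g x)
    have hφ : ConvexOn ℝ K (fun v => γ * f v) :=
      (hfcv.subset (Set.subset_univ K) hKcv).smul hγ.le
    refine norm_sub_le_of_prox_variational (φ := fun v => γ * f v)
      (inner_sub_le_of_isMinOn_prox hφ hPK hsol.1 hmin) ?_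
    have h := mul_le_mul_of_nonneg_left (hsol.2 _ hPK) hγ.le
    rw [sub_sub_cancel_left, inner_neg_left, real_inner_smul_left]
    linarith
  have hproj_sq : ∀ x, ‖P (T x - γ • g x) - T wstar‖ ^ 2
      ≤ (η ^ 2 - 2 * γ * α + γ ^ 2 * β ^ 2) * ‖x - wstar‖ ^ 2 := by
    intro x
    have h1 := pow_le_pow_left₀ (norm_nonneg _) (hproj x) 2
    have e : (T x - γ • g x) - (T wstar - γ • g wstar)
        = (T x - T wstar) - γ • (g x - g wstar) := by module
    rw [e, norm_sub_sq_real (T x - T wstar), real_inner_smul_right, norm_smul, mul_pow,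
      Real.norm_eq_abs, sq_abs] at h1
    have h2 := pow_le_pow_left₀ (norm_nonneg _) (hT_lip x wstar) 2
    have h3 := mul_le_mul_of_nonneg_left
      (pow_le_pow_left₀ (norm_nonneg _) (hg_lip x wstar) 2) (sq_nonneg γ)
    have h4 := mul_le_mul_of_nonneg_left (hcoupled x wstar) hγ.le
    linarith
  have hA_eq : ∀ x, A x = (T x - T wstar) - (P (T x - γ • g x) - T wstar) := by
    intro x
    rw [hA]
    abel
  have hA_mono : ∀ x, a * ‖x - wstar‖ ^ 2 ≤ ⟪A x, x - wstar⟫ := by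
    intro x
    rw [hA_eq, inner_sub_left]
    have h1 := real_inner_le_norm (P (T x - γ • g x) - T wstar) (x - wstar)
    have h2 := two_mul_le_add_sq ‖P (T x - γ • g x) - T wstar‖ ‖x - wstar‖
    rw [ha_def]
    linarith [hproj_sq x, hT_mono x wstar]
  have hA_lip : ∀ x, ‖A x‖ ≤ (2 * η + γ * β) * ‖x - wstar‖ := by
    intro x
    rw [hA_eq]
    have h1 := norm_sub_le (T x - T wstar) (P (T x - γ • g x) - T wstar)
    have e : (T x - γ • g x) - (T wstar - γ • g wstar)
        = (T x - T wstar) - γ • (g x - g wstar) := by module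
    have h2 := (hproj x).trans_eq (congrArg norm e)
    have h3 := norm_sub_le (T x - T wstar) (γ • (g x - g wstar))
    rw [norm_smul, Real.norm_eq_abs, abs_of_pos hγ] at h3
    have h4 := mul_le_mul_of_nonneg_left (hg_lip x wstar) hγ.le
    linarith [hT_lip x wstar]
  have ha₁ : 0 ≤ a₁ := by
    rw [ha₁_def]
    positivity
  have hA_coco : ∀ x, a₁ * ‖A x‖ ^ 2 ≤ ⟪A x, x - wstar⟫ := by
    intro x
    refine le_trans ?_ (hA_mono x)
    rcases eq_or_ne ((2 * η + γ * β) ^ 2) 0 with h0 | h0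
    · rw [ha₁_def, h0, div_zero, zero_mul]
      positivity
    · calc a₁ * ‖A x‖ ^ 2 ≤ a₁ * ((2 * η + γ * β) * ‖x - wstar‖) ^ 2 :=
          mul_le_mul_of_nonneg_left (pow_le_pow_left₀ (norm_nonneg _) (hA_lip x) 2) ha₁
        _ = a * ‖x - wstar‖ ^ 2 := by
          rw [ha₁_def, mul_pow, ← mul_assoc, div_mul_cancel₀ _ h0]
  have hρ : ρ * (4 - κ) ≤ a₁ * κ ^ 2 := by
    have h := hρ₁.le.trans (mul_le_mul_of_nonneg_left (min_le_right _ _) ha₁)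
    rwa [← mul_div_assoc, le_div_iff₀ (by linarith)] at h
  obtain ⟨q, hq0, hq1, C, hC, hconv⟩ := inertial_linear_convergence
    (u := fun n => w n - wstar) (y := fun n => A (w n)) ha_pos hκ₀ hκ₁ hρ₀ hρ
    (fun n => hA_mono (w n)) (fun n => hA_coco (w n)) (fun n => by
      have h := hrec (n + 1) (by omega)
      rw [Nat.add_sub_cancel] at h
      simp only [h, sub_sub_sub_cancel_right]
      abel)
  refine ⟨q⁻¹, (one_lt_inv₀ hq0).2 hq1, C / q, by positivity, fun k hk => ?_⟩
  have hk' : (1 : ℝ) ≤ k := by exact_mod_cast hk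
  rw [inv_pow, div_inv_eq_mul]
  calc ‖w (k + 1) - wstar‖ ^ 2 ≤ C * q ^ k := hconv k
    _ = C / q * 1 * q ^ (k + 1) := by
      rw [pow_succ]
      field_simp
    _ ≤ (C / q * k + q⁻¹ * ‖w 1 - wstar‖ ^ 2) * q ^ (k + 1) := by
      gcongr
      have h1 : C / q * 1 ≤ C / q * k := by gcongr
      have h2 : 0 ≤ q⁻¹ * ‖w 1 - wstar‖ ^ 2 := by positivity
      linarith
end

section
/- Let w₁, w₂ ∈ H, and suppose p₁ ∈ K minimizes v ↦ γ·f(v) + (1/2)‖w₁ − v‖² over K and p₂ ∈ K minimizes v ↦ γ·f(v) + (1/2)‖w₂ − v‖² over K. Then ‖p₁ − p₂‖ ≤ ‖w₁ − w₂‖ (nonexpansiveness of the generalized f-projection). -/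
open scoped RealInnerProductSpace

/-- A minimizer over a convex set of a convex function plus half the squared distance to `w`
satisfies the associated variational inequality. -/
theorem ConvexOn.inner_sub_le_of_forall_add_sq_le
    {H : Type*} [NormedAddCommGroup H] [InnerProductSpace ℝ H]
    {K : Set H} {g : H → ℝ} (hg : ConvexOn ℝ K g) {w p v : H} (hpK : p ∈ K) (hvK : v ∈ K)
    (hp : ∀ u ∈ K, g p + (1 / 2) * ‖w - p‖ ^ 2 ≤ g u + (1 / 2) * ‖w - u‖ ^ 2) :
    ⟪w - p, v - p⟫ ≤ g v - g p := by
  have key : ∀ t : ℝ, 0 < t → t ≤ 1 →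
      ⟪w - p, v - p⟫ ≤ g v - g p + t / 2 * ‖v - p‖ ^ 2 := by
    intro t ht0 ht1
    have hmin := hp _ (hg.1 hpK hvK (sub_nonneg.2 ht1) ht0.le (by ring))
    have hconv := hg.2 hpK hvK (sub_nonneg.2 ht1) ht0.le (by ring)
    have hsub : w - ((1 - t) • p + t • v) = (w - p) - t • (v - p) := by module
    rw [hsub, norm_sub_sq_real (w - p), inner_smul_right, norm_smul, Real.norm_eq_abs, mul_pow,
      sq_abs] at hmin
    simp only [smul_eq_mul] at hconv
    refine le_of_mul_le_mul_left ?_ ht0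
    linarith
  have hlim : Filter.Tendsto (fun t : ℝ => g v - g p + t / 2 * ‖v - p‖ ^ 2)
      (nhdsWithin 0 (Set.Ioi 0)) (nhds (g v - g p)) := by
    have hcont : Continuous fun t : ℝ => g v - g p + t / 2 * ‖v - p‖ ^ 2 := by fun_prop
    simpa using (hcont.tendsto 0).mono_left nhdsWithin_le_nhds
  refine ge_of_tendsto hlim ?_
  filter_upwards [Ioc_mem_nhdsGT (zero_lt_one (α := ℝ))] with t ht
  exact key t ht.1 ht.2

/-- Nonexpansiveness of the generalized `f`-projection. -/
theorem stmt_17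
    {H : Type*} [NormedAddCommGroup H] [InnerProductSpace ℝ H] [CompleteSpace H]
    (K : Set H) (hKne : K.Nonempty) (hKcl : IsClosed K) (hKcv : Convex ℝ K)
    (f : H → ℝ) (hfcv : ConvexOn ℝ Set.univ f) (hflsc : LowerSemicontinuous f)
    (γ : ℝ) (hγ : 0 < γ)
    (w₁ w₂ p₁ p₂ : H) (hp₁K : p₁ ∈ K) (hp₂K : p₂ ∈ K)
    (hp₁ : ∀ v ∈ K, γ * f p₁ + (1 / 2) * ‖w₁ - p₁‖ ^ 2 ≤
        γ * f v + (1 / 2) * ‖w₁ - v‖ ^ 2)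
    (hp₂ : ∀ v ∈ K, γ * f p₂ + (1 / 2) * ‖w₂ - p₂‖ ^ 2 ≤
        γ * f v + (1 / 2) * ‖w₂ - v‖ ^ 2) :
    ‖p₁ - p₂‖ ≤ ‖w₁ - w₂‖ := by
  have hg : ConvexOn ℝ K fun v => γ * f v :=
    (hfcv.subset (Set.subset_univ K) hKcv).smul hγ.le
  have h₁ := hg.inner_sub_le_of_forall_add_sq_le hp₁K hp₂K hp₁
  have h₂ := hg.inner_sub_le_of_forall_add_sq_le hp₂K hp₁K hp₂
  have hsum : ⟪w₁ - p₁, p₂ - p₁⟫ + ⟪w₂ - p₂, p₁ - p₂⟫ =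
      ‖p₁ - p₂‖ ^ 2 - ⟪w₁ - w₂, p₁ - p₂⟫ := by
    rw [← real_inner_self_eq_norm_sq, ← neg_sub p₁ p₂, inner_neg_right, ← inner_neg_left,
      ← inner_add_left, ← inner_sub_left]
    congr 1
    abel
  have hcs := real_inner_le_norm (w₁ - w₂) (p₁ - p₂)
  have hsq : ‖p₁ - p₂‖ * ‖p₁ - p₂‖ ≤ ‖w₁ - w₂‖ * ‖p₁ - p₂‖ := by
    linarith [sq ‖p₁ - p₂‖]
  rcases (norm_nonneg (p₁ - p₂)).eq_or_lt with h | h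
  · exact h ▸ norm_nonneg _
  · exact le_of_mul_le_mul_right hsq h
end
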